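/- arXiv:2010.12018 — 6 statements merged into one kernel-verified Lean document; each statement's English description precedes it below -/
import Mathlib

section
/- Let P and Q be finite posets, each equipped with a fixed-point-free involutive order-automorphism x ↦ -x (that is, an order-preserving bijection with -(-x) = x and -x ≠ x for all x), and suppose that the geometric realizations ‖P‖ and ‖Q‖ of their order complexes are both homeomorphic to the sphere S^{d-1}. If φ : P → Q is an order-preserving map satisfying φ(-x) = -φ(x) for all x ∈ P, then φ is surjective. -/
namespace PosetBU

section Chains
variable {V : Type*}

/-- mod 2 chains of ordered tuples -/
abbrev Ch (V : Type*) := List V →₀ ZMod 2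

noncomputable def cone (b : V) : Ch V →ₗ[ZMod 2] Ch V :=
  Finsupp.lmapDomain (ZMod 2) (ZMod 2) (fun l => b :: l)

noncomputable def push (ν : V → V) : Ch V →ₗ[ZMod 2] Ch V :=
  Finsupp.lmapDomain (ZMod 2) (ZMod 2) (fun l => l.map ν)

/-- boundary of a single list -/
noncomputable def bdl : List V → Ch V
  | [] => 0
  | x :: l => Finsupp.single l 1 + cone x (bdl l)

noncomputable def bd : Ch V →ₗ[ZMod 2] Ch V := Finsupp.linearCombination (ZMod 2) bdl

@[simp] lemma bd_single (l : List V) (a : ZMod 2) : bd (Finsupp.single l a) = a • bdl l := by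
  simp [bd]

@[simp] lemma cone_single (b : V) (l : List V) (a : ZMod 2) :
    cone b (Finsupp.single l a) = Finsupp.single (b :: l) a := by
  simp [cone]

@[simp] lemma push_single (ν : V → V) (l : List V) (a : ZMod 2) :
    push ν (Finsupp.single l a) = Finsupp.single (l.map ν) a := by
  simp [push]

lemma two_self (c : Ch V) : c + c = 0 := by
  ext l; simp [CharTwo.add_self_eq_zero]

lemma lin_ext {M : Type*} [AddCommMonoid M] [Module (ZMod 2) M] {f g : Ch V →ₗ[ZMod 2] M}
    (h : ∀ l, f (Finsupp.single l 1) = g (Finsupp.single l 1)) : f = g := by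
  apply Finsupp.lhom_ext
  intro l a
  have : Finsupp.single l a = a • Finsupp.single l (1 : ZMod 2) := by simp
  rw [this, map_smul, map_smul, h]

lemma bd_cone (b : V) (c : Ch V) : bd (cone b c) = c + cone b (bd c) := by
  have : bd ∘ₗ cone b = LinearMap.id + cone b ∘ₗ bd := by
    apply lin_ext; intro l; simp [bdl]
  exact LinearMap.congr_fun this c

lemma bd_bdl (l : List V) : bd (bdl l) = 0 := by
  induction l with
  | nil => simp [bdl]
  | cons x l ih => simp [bdl, bd_cone, ih, two_self]

lemma bd_bd (c : Ch V) : bd (bd c) = 0 := by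
  have : bd ∘ₗ bd = (0 : Ch V →ₗ[ZMod 2] Ch V) := by
    apply lin_ext; intro l; simp [bd_bdl]
  exact LinearMap.congr_fun this c

lemma push_cone (ν : V → V) (b : V) (c : Ch V) : push ν (cone b c) = cone (ν b) (push ν c) := by
  have : push ν ∘ₗ cone b = cone (ν b) ∘ₗ push ν := by
    apply lin_ext; intro l; simp
  exact LinearMap.congr_fun this c

lemma push_bdl (ν : V → V) (l : List V) : push ν (bdl l) = bdl (l.map ν) := by
  induction l with
  | nil => simp [bdl]
  | cons x l ih => simp [bdl, push_cone, ih]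

lemma push_bd (ν : V → V) (c : Ch V) : push ν (bd c) = bd (push ν c) := by
  have : push ν ∘ₗ bd = bd ∘ₗ push ν := by
    apply lin_ext; intro l; simp [push_bdl]
  exact LinearMap.congr_fun this c

lemma push_push (ν : V → V) (hν : ∀ x, ν (ν x) = x) (c : Ch V) : push ν (push ν c) = c := by
  have : push ν ∘ₗ push ν = LinearMap.id := by
    apply lin_ext; intro l
    have : ν ∘ ν = id := funext hν
    simp [this]
  exact LinearMap.congr_fun this c

/-- subdivision operators -/
noncomputable def sd (b : List V → V) : ℕ → (Ch V →ₗ[ZMod 2] Ch V)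
  | 0 => LinearMap.id
  | n + 1 => Finsupp.linearCombination (ZMod 2) (fun l => cone (b l) (sd b n (bdl l)))

lemma sd_succ_single (b : List V → V) (n : ℕ) (l : List V) :
    sd b (n+1) (Finsupp.single l 1) = cone (b l) (sd b n (bdl l)) := by
  simp [sd]

lemma bd_sd (b : List V → V) (n : ℕ) (c : Ch V) : bd (sd b (n+1) c) = sd b n (bd c) := by
  induction n generalizing c with
  | zero =>
    have : bd ∘ₗ sd b 1 = sd b 0 ∘ₗ bd := by
      apply lin_ext; intro l
      simp only [LinearMap.comp_apply, sd_succ_single, bd_cone]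
      simp [sd, bd_bdl]
    exact LinearMap.congr_fun this c
  | succ n ih =>
    have : bd ∘ₗ sd b (n+2) = sd b (n+1) ∘ₗ bd := by
      apply lin_ext; intro l
      simp only [LinearMap.comp_apply, sd_succ_single, bd_cone, ih, bd_bdl]
      simp
    exact LinearMap.congr_fun this c

lemma push_sd (ν : V → V) (b : List V → V) (hb : ∀ l, b (l.map ν) = ν (b l)) (n : ℕ) (c : Ch V) :
    push ν (sd b n c) = sd b n (push ν c) := by
  induction n generalizing c with
  | zero => simp [sd]
  | succ n ih =>
    have : push ν ∘ₗ sd b (n+1) = sd b (n+1) ∘ₗ push ν := by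
      apply lin_ext; intro l
      simp only [LinearMap.comp_apply, sd_succ_single, push_single, push_cone, ih, push_bdl, hb]
    exact LinearMap.congr_fun this c

/-- chains supported on a set of lists -/
abbrev Supp (s : Set (List V)) : Submodule (ZMod 2) (Ch V) := Finsupp.supported (ZMod 2) (ZMod 2) s

lemma supp_map {s t : Set (List V)} (f : Ch V →ₗ[ZMod 2] Ch V)
    (h : ∀ l ∈ s, f (Finsupp.single l 1) ∈ Supp t) {c : Ch V} (hc : c ∈ Supp s) :
    f c ∈ Supp t := by
  have : Supp s ≤ (Supp t).comap f := by
    rw [Supp, Finsupp.supported_eq_span_single, Submodule.span_le]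
    rintro _ ⟨l, hl, rfl⟩
    exact h l hl
  exact this hc

lemma cone_supp {s t : Set (List V)} (b : V) (h : ∀ l ∈ s, b :: l ∈ t) {c : Ch V}
    (hc : c ∈ Supp s) : cone b c ∈ Supp t := by
  refine supp_map (cone b) ?_ hc
  intro l hl
  rw [cone_single]
  exact Finsupp.single_mem_supported _ _ (h l hl)

lemma push_supp {s t : Set (List V)} (ν : V → V) (h : ∀ l ∈ s, l.map ν ∈ t) {c : Ch V}
    (hc : c ∈ Supp s) : push ν c ∈ Supp t := by
  refine supp_map (push ν) ?_ hc
  intro l hl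
  rw [push_single]
  exact Finsupp.single_mem_supported _ _ (h l hl)

lemma bdl_supp (l : List V) : bdl l ∈ Supp {m | m.Sublist l ∧ m.length + 1 = l.length} := by
  induction l with
  | nil => simp [bdl]
  | cons x l ih =>
    rw [bdl]
    refine Submodule.add_mem _ (Finsupp.single_mem_supported _ _ ?_) (cone_supp _ ?_ ih)
    · simp
    · rintro m ⟨h1, h2⟩
      simp [h1, h2]

end Chains

section Cochains
variable {V : Type*} (s : ℕ → V → ZMod 2)

def bet : List V → ZMod 2
  | [] => 0
  | [_] => 1
  | x :: y :: l => (s (l.length + 1) x + s (l.length + 1) y) * bet (y :: l)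

def alp : List V → ZMod 2
  | [] => 1
  | x :: l => s (l.length + 1) x * bet s (x :: l)

noncomputable def ev (f : List V → ZMod 2) : Ch V →ₗ[ZMod 2] ZMod 2 :=
  Finsupp.linearCombination (ZMod 2) f

@[simp] lemma ev_single (f : List V → ZMod 2) (l : List V) (a : ZMod 2) :
    ev f (Finsupp.single l a) = a * f l := by simp [ev]

lemma ev_cone (f : List V → ZMod 2) (b : V) (c : Ch V) :
    ev f (cone b c) = ev (fun l => f (b :: l)) c := by
  have : ev f ∘ₗ cone b = ev (fun l => f (b :: l)) := by apply lin_ext; intro l; simp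
  exact LinearMap.congr_fun this c

lemma ev_push (f : List V → ZMod 2) (ν : V → V) (c : Ch V) :
    ev f (push ν c) = ev (fun l => f (l.map ν)) c := by
  have : ev f ∘ₗ push ν = ev (fun l => f (l.map ν)) := by apply lin_ext; intro l; simp
  exact LinearMap.congr_fun this c

lemma ev_congr {f g : List V → ZMod 2} {t : Set (List V)} (h : ∀ l ∈ t, f l = g l) {c : Ch V}
    (hc : c ∈ Supp t) : ev f c = ev g c := by
  rw [ev, ev, Finsupp.linearCombination_apply, Finsupp.linearCombination_apply]
  apply Finsupp.sum_congr
  intro l hl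
  rw [h l (hc hl)]

lemma ev_smul (f : List V → ZMod 2) (a : ZMod 2) (c : Ch V) :
    ev (fun l => a * f l) c = a * ev f c := by
  have : ev (fun l => a * f l) = a • ev f := by apply lin_ext; intro l; simp
  rw [this]; rfl

lemma ev_add (f g : List V → ZMod 2) (c : Ch V) :
    ev (fun l => f l + g l) c = ev f c + ev g c := by
  have : ev (fun l => f l + g l) = ev f + ev g := by apply lin_ext; intro l; simp
  rw [this]; rfl

lemma z2 (a b c e : ZMod 2) : (a + b) * e + (a + c) * e = (c + b) * e := by
  revert a b c e; decide

lemma ev_bet_cons (l : List V) (hl : l ≠ []) (x : V) :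
    ev (fun m => bet s (x :: m)) (bdl l) = bet s l := by
  induction l generalizing x with
  | nil => exact absurd rfl hl
  | cons y l ih =>
    rw [bdl, map_add, ev_single, ev_cone, one_mul]
    have h1 : ev (fun m => bet s (x :: y :: m)) (bdl l) =
        ev (fun m => (s l.length x + s l.length y) * bet s (y :: m)) (bdl l) := by
      apply ev_congr _ (bdl_supp l)
      rintro m ⟨_, hm⟩
      simp [bet, hm]
    rw [h1, ev_smul]
    cases l with
    | nil => simp [bdl, bet]
    | cons w l =>
      rw [ih (by simp) y]
      simp only [bet, List.length_cons]
      exact z2 _ _ _ _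

lemma ev_alp_bdl (l : List V) (hl : l ≠ []) : ev (alp s) (bdl l) = bet s l := by
  cases l with
  | nil => exact absurd rfl hl
  | cons x l =>
    rw [bdl, map_add, ev_single, ev_cone, one_mul]
    have h1 : ev (fun m => alp s (x :: m)) (bdl l) =
        ev (fun m => s l.length x * bet s (x :: m)) (bdl l) := by
      apply ev_congr _ (bdl_supp l)
      rintro m ⟨_, hm⟩
      simp [alp, hm]
    rw [h1, ev_smul]
    cases l with
    | nil => simp [bdl, bet, alp]
    | cons w l =>
      rw [ev_bet_cons s _ (by simp)]
      simp only [bet, alp, List.length_cons]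
      ring

lemma bet_push (ν : V → V) (l : List V)
    (h : ∀ x ∈ l, ∀ k, s k (ν x) = s k x + 1) : bet s (l.map ν) = bet s l := by
  induction l with
  | nil => rfl
  | cons x l ih =>
    cases l with
    | nil => rfl
    | cons y l =>
      have := ih (fun z hz => h z (List.mem_cons_of_mem _ hz))
      simp only [List.map_cons] at this ⊢
      simp only [bet, this, List.length_map]
      rw [h x (by simp), h y (by simp)]
      congr 1
      generalize s (l.length+1) x = a; generalize s (l.length+1) y = b
      revert a b; decide

lemma alp_push (ν : V → V) (l : List V) (hl : l ≠ [])
    (h : ∀ x ∈ l, ∀ k, s k (ν x) = s k x + 1) : alp s l + alp s (l.map ν) = bet s l := by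
  cases l with
  | nil => exact absurd rfl hl
  | cons x l =>
    have := bet_push s ν (x :: l) h
    simp only [List.map_cons] at this ⊢
    simp only [alp, this, List.length_map]
    rw [h x (by simp)]
    generalize s (l.length+1) x = a; generalize bet s (x :: l) = b
    revert a b; decide

lemma bet_ne (l : List V) (hl : bet s l ≠ 0) (k : ℕ) (hk : 1 ≤ k) (hk' : k < l.length) :
    ∃ x ∈ l, ∃ y ∈ l, s k x ≠ s k y := by
  induction l with
  | nil => simp at hk'
  | cons x l ih =>
    cases l with
    | nil => simp at hk'; omega
    | cons y l =>
      simp only [bet] at hl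
      have h1 := left_ne_zero_of_mul hl
      have h2 := right_ne_zero_of_mul hl
      simp only [List.length_cons] at hk'
      rcases Nat.lt_or_ge k (l.length + 1) with h | h
      · obtain ⟨a, ha, b, hb, hab⟩ := ih h2 (by simpa using h)
        exact ⟨a, by simp [ha], b, by simp [hb], hab⟩
      · obtain rfl : k = l.length + 1 := by omega
        refine ⟨x, by simp, y, by simp, ?_⟩
        intro h; apply h1; rw [h]; exact CharTwo.add_self_eq_zero _

/-- The key parity argument. -/
lemma parity (ν : V → V) (z c : ℕ → Ch V) (n : ℕ) (hz0 : z 0 = Finsupp.single [] 1)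
    (hzc : ∀ k, z (k+1) = c k + push ν (c k)) (hbd : ∀ k, bd (c k) = z k)
    (hs : ∀ k ≤ n, c k ∈ Supp {l | l ≠ [] ∧ ∀ x ∈ l, ∀ k, s k (ν x) = s k x + 1}) :
    ∀ k ≤ n + 1, ev (alp s) (z k) = 1 := by
  intro k
  induction k with
  | zero => intro; simp [hz0, alp]
  | succ k ih =>
    intro hk
    rw [← ih (by omega), ← hbd k, hzc, map_add, ev_push, ← ev_add]
    have h1 : ev (alp s) (bd (c k)) = ev (fun l => ev (alp s) (bdl l)) (c k) := by
      have : ev (alp s) ∘ₗ bd = ev (fun l => ev (alp s) (bdl l)) := by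
        apply lin_ext; intro l; simp
      exact LinearMap.congr_fun this (c k)
    rw [h1]
    apply ev_congr _ (hs k (by omega))
    rintro l ⟨hl, h⟩
    rw [ev_alp_bdl s l hl, alp_push s ν l hl h]

end Cochains

section Mesh
variable {V : Type*} [NormedAddCommGroup V] [NormedSpace ℝ V]

noncomputable def bary (l : List V) : V := (l.length : ℝ)⁻¹ • l.sum

lemma bary_neg (l : List V) : bary (l.map (fun x => -x)) = - bary l := by
  have : (l.map (fun x => -x)).sum = - l.sum := by
    induction l with
    | nil => simp
    | cons x l ih => simp [ih, add_comm]
  simp [bary, this]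

lemma bary_mem (l : List V) (hl : l ≠ []) : bary l ∈ convexHull ℝ {x | x ∈ l} := by
  have key : ∀ m : List V, (∀ x ∈ m, x ∈ l) → m ≠ [] → bary m ∈ convexHull ℝ {x | x ∈ l} := by
    intro m
    induction m with
    | nil => intro _ h; exact absurd rfl h
    | cons x m ih =>
      intro hm _
      have hx : x ∈ convexHull ℝ {x | x ∈ l} := subset_convexHull _ _ (hm x (by simp))
      by_cases h : m = []
      · subst h; simpa [bary] using hx
      · have := ih (fun y hy => hm y (by simp [hy])) h
        have hp : (0 : ℝ) < m.length := by
          have := List.length_pos_iff.2 h; exact_mod_cast this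
        have h2 := (convex_convexHull ℝ {x | x ∈ l}) hx this
          (a := ((m.length : ℝ) + 1)⁻¹) (b := ((m.length : ℝ) + 1)⁻¹ * m.length)
          (by positivity) (by positivity) (by field_simp; ring)
        convert h2 using 1
        simp only [bary, List.length_cons, List.sum_cons, smul_add, smul_smul]
        congr 2
        · push_cast; rfl
        · push_cast; field_simp
  exact key l (fun _ h => h) hl

lemma dist_bary_le (l : List V) (D : ℝ) (x : V) (hx : x ∈ l)
    (hD : ∀ y ∈ l, dist y x ≤ D) : dist (bary l) x ≤ (l.length - 1) / l.length * D := by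
  have hp : (0 : ℝ) < l.length := by
    have := List.length_pos_of_mem hx; exact_mod_cast this
  have h1 : ∀ m : List V, (m.sum - (m.length : ℝ) • x) = (m.map (fun y => y - x)).sum := by
    intro m
    induction m with
    | nil => simp
    | cons y m ih => simp only [List.sum_cons, List.length_cons, List.map_cons, ← ih]
                     push_cast; module
  have h2 : ∀ m : List V, (∀ y ∈ m, dist y x ≤ D) →
      ‖(m.map (fun y => y - x)).sum‖ ≤ m.length * D := by
    intro m
    induction m with
    | nil => simp
    | cons y m ih =>
      intro h
      simp only [List.map_cons, List.sum_cons, List.length_cons]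
      refine (norm_add_le _ _).trans ?_
      have := ih (fun z hz => h z (by simp [hz]))
      have h3 := h y (by simp)
      rw [dist_eq_norm] at h3
      push_cast; linarith
  have h3 : ‖(l.map (fun y => y - x)).sum‖ ≤ (l.length - 1) * D := by
    obtain ⟨a, b, rfl⟩ := List.append_of_mem hx
    have := h2 (a ++ b) (fun y hy => hD y (by simp at hy ⊢; tauto))
    simp only [List.map_append, List.map_cons, List.sum_append, List.sum_cons, sub_self, zero_add,
      List.length_append, List.length_cons] at this ⊢
    push_cast at this ⊢
    convert this using 2
    ring
  have : bary l - x = (l.length : ℝ)⁻¹ • (l.map (fun y => y - x)).sum := by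
    rw [← h1, smul_sub, smul_smul, inv_mul_cancel₀ hp.ne', one_smul, bary]
  rw [dist_eq_norm, this, norm_smul, norm_inv, Real.norm_of_nonneg hp.le]
  rw [inv_mul_le_iff₀ hp]
  refine h3.trans (le_of_eq ?_)
  field_simp

lemma sd_mesh (N : ℕ) (D : ℝ) (hD : 0 ≤ D) (n : ℕ) (hn : n ≤ N + 1) (l : List V)
    (hl : l.length = n) (hd : ∀ x ∈ l, ∀ y ∈ l, dist x y ≤ D) :
    sd bary n (Finsupp.single l 1) ∈ Supp {m | m.length = n ∧
      (∀ x ∈ m, x ∈ convexHull ℝ {x | x ∈ l}) ∧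
      ∀ x ∈ m, ∀ y ∈ m, dist x y ≤ (N / (N + 1) : ℝ) * D} := by
  induction n generalizing l with
  | zero =>
    obtain rfl : l = [] := List.length_eq_zero_iff.1 hl
    exact Finsupp.single_mem_supported _ _ (by simp)
  | succ n ih =>
    rw [sd_succ_single]
    have hne : l ≠ [] := by rintro rfl; simp at hl
    have h1 : sd bary n (bdl l) ∈ Supp {m | m.length = n ∧
      (∀ x ∈ m, x ∈ convexHull ℝ {x | x ∈ l}) ∧
      ∀ x ∈ m, ∀ y ∈ m, dist x y ≤ (N / (N + 1) : ℝ) * D} := by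
      refine supp_map _ ?_ (bdl_supp l)
      rintro m ⟨hm, hm2⟩
      have := ih (by omega) m (by omega)
        (fun x hx y hy => hd x (hm.subset hx) y (hm.subset hy))
      refine Finsupp.supported_mono ?_ this
      rintro p ⟨h1, h2, h3⟩
      refine ⟨h1, fun x hx => ?_, h3⟩
      exact convexHull_mono (fun y hy => hm.subset hy) (h2 x hx)
    refine cone_supp _ ?_ h1
    rintro m ⟨h1, h2, h3⟩
    have hb := bary_mem l hne
    have hdist : ∀ x ∈ convexHull ℝ {x | x ∈ l}, dist x (bary l) ≤ (N / (N + 1) : ℝ) * D := by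
      have : convexHull ℝ {x | x ∈ l} ⊆ Metric.closedBall (bary l) ((N / (N + 1) : ℝ) * D) := by
        apply convexHull_min _ (convex_closedBall _ _)
        intro x hx
        rw [Metric.mem_closedBall, dist_comm]
        refine (dist_bary_le l D x hx (fun y hy => hd y hy x hx)).trans ?_
        rw [hl]
        have : (n : ℝ) ≤ N := by exact_mod_cast (by omega : n ≤ N)
        apply mul_le_mul_of_nonneg_right _ hD
        push_cast
        rw [div_le_div_iff₀ (by positivity) (by positivity)]
        nlinarith
      exact this
    refine ⟨by simp [h1], ?_, ?_⟩
    · intro x hx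
      rcases List.mem_cons.1 hx with rfl | hx
      · exact hb
      · exact h2 x hx
    · intro x hx y hy
      rcases List.mem_cons.1 hx with rfl | hx <;> rcases List.mem_cons.1 hy with rfl | hy
      · rw [dist_self]; positivity
      · rw [dist_comm]; exact hdist y (h2 y hy)
      · exact hdist x (h2 x hx)
      · exact h3 x hx y hy

/-- lists of length `n`, of mesh at most `D`, contained in one of the convex sets `C i` -/
def Small {ι : Type*} (C : ι → Set V) (n : ℕ) (D : ℝ) : Set (List V) :=
  {m | m.length = n ∧ (∃ i, ∀ x ∈ m, x ∈ C i) ∧ ∀ x ∈ m, ∀ y ∈ m, dist x y ≤ D}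

lemma sd_small {ι : Type*} (C : ι → Set V) (hC : ∀ i, Convex ℝ (C i)) (N : ℕ) (D : ℝ)
    (hD : 0 ≤ D) (n : ℕ) (hn : n ≤ N + 1) (c : Ch V) (hc : c ∈ Supp (Small C n D)) :
    sd bary n c ∈ Supp (Small C n ((N / (N + 1) : ℝ) * D)) := by
  refine supp_map _ ?_ hc
  rintro l ⟨h1, ⟨i, h2⟩, h3⟩
  refine Finsupp.supported_mono ?_ (sd_mesh N D hD n hn l h1 h3)
  rintro m ⟨g1, g2, g3⟩
  refine ⟨g1, ⟨i, fun x hx => ?_⟩, g3⟩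
  exact convexHull_min h2 (hC i) (g2 x hx)

lemma sd_iter_small {ι : Type*} (C : ι → Set V) (hC : ∀ i, Convex ℝ (C i)) (N : ℕ) (D : ℝ)
    (hD : 0 ≤ D) (n : ℕ) (hn : n ≤ N + 1) (c : Ch V) (hc : c ∈ Supp (Small C n D)) (j : ℕ) :
    (sd bary n)^[j] c ∈ Supp (Small C n ((N / (N + 1) : ℝ) ^ j * D)) := by
  induction j with
  | zero => simpa using hc
  | succ j ih =>
    rw [Function.iterate_succ_apply', pow_succ', mul_assoc]
    exact sd_small C hC N _ (by positivity) n hn _ ih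

end Mesh

section BU

/-- octahedral chains -/
noncomputable def oct {V : Type*} [Neg V] (e : ℕ → V) : ℕ → Ch V
  | 0 => Finsupp.single [] 1
  | k + 1 => cone (e k) (oct e k) + push (fun x => -x) (cone (e k) (oct e k))

lemma push_oct {V : Type*} [InvolutiveNeg V] (e : ℕ → V) (k : ℕ) :
    push (fun x => -x) (oct e k) = oct e k := by
  cases k with
  | zero => simp [oct]
  | succ k => rw [oct, map_add, push_push _ (fun x => neg_neg x), add_comm]

lemma bd_oct {V : Type*} [InvolutiveNeg V] (e : ℕ → V) (k : ℕ) : bd (oct e k) = 0 := by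
  induction k with
  | zero => simp [oct, bdl]
  | succ k ih =>
    rw [oct, map_add, ← push_bd, bd_cone, ih, map_zero, add_zero, push_oct, two_self]

lemma bd_cone_oct {V : Type*} [InvolutiveNeg V] (e : ℕ → V) (k : ℕ) :
    bd (cone (e k) (oct e k)) = oct e k := by
  rw [bd_cone, bd_oct, map_zero, add_zero]

/-- standard basis vectors, extended by zero -/
noncomputable def ee (n : ℕ) (k : ℕ) : Fin n → ℝ := fun i => if (i : ℕ) = k then 1 else 0

/-- faces of the octahedron -/
def face (n : ℕ) (s : Fin n → ℤˣ) : Set (Fin n → ℝ) :=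
  {x | (∀ i, 0 ≤ ((s i : ℤ) : ℝ) * x i) ∧ ∑ i, ((s i : ℤ) : ℝ) * x i = 1}

lemma face_convex (n : ℕ) (s : Fin n → ℤˣ) : Convex ℝ (face n s) := by
  rintro x ⟨hx, hx'⟩ y ⟨hy, hy'⟩ a b ha hb hab
  have h : ∀ i, ((s i : ℤ) : ℝ) * (a • x + b • y) i =
      a * (((s i : ℤ) : ℝ) * x i) + b * (((s i : ℤ) : ℝ) * y i) := by
    intro i; simp; ring
  refine ⟨fun i => ?_, ?_⟩
  · rw [h]; exact add_nonneg (mul_nonneg ha (hx i)) (mul_nonneg hb (hy i))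
  · simp_rw [h]
    rw [Finset.sum_add_distrib, ← Finset.mul_sum, ← Finset.mul_sum, hx', hy']; linarith

def octS (n : ℕ) : Set (Fin n → ℝ) := {x | ∑ i, |x i| = 1}

lemma face_sub (n : ℕ) (s : Fin n → ℤˣ) (x : Fin n → ℝ) (hx : x ∈ face n s) : x ∈ octS n := by
  obtain ⟨h1, h2⟩ := hx
  rw [octS, Set.mem_ofPred_eq, ← h2]
  apply Finset.sum_congr rfl
  intro i _
  rw [← abs_of_nonneg (h1 i), abs_mul]
  rcases Int.units_eq_one_or (s i) with h | h <;> simp [h]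

lemma octS_le {n : ℕ} {x : Fin n → ℝ} (hx : x ∈ octS n) (i : Fin n) : |x i| ≤ 1 := by
  rw [← show ∑ i, |x i| = 1 from hx]
  exact Finset.single_le_sum (f := fun i => |x i|) (fun i _ => abs_nonneg _) (Finset.mem_univ i)

lemma octS_ne {n : ℕ} {x : Fin n → ℝ} (hx : x ∈ octS n) : x ≠ 0 := by
  rintro rfl; simp [octS] at hx

lemma octS_compact (n : ℕ) : IsCompact (octS n) := by
  apply Metric.isCompact_of_isClosed_isBounded
  · exact isClosed_eq (by fun_prop) continuous_const
  · refine (Metric.isBounded_closedBall (x := (0 : Fin n → ℝ)) (r := 1)).subset ?_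
    intro x hx
    rw [mem_closedBall_zero_iff, pi_norm_le_iff_of_nonneg zero_le_one]
    exact fun i => octS_le hx i

lemma oct_supp (n k : ℕ) (hk : k ≤ n) : oct (ee n) k ∈ Supp {l | l.length = k ∧
    ∃ s : Fin n → ℤˣ, ∀ x ∈ l, ∃ i : Fin n, (i : ℕ) < k ∧ x = ((s i : ℤ) : ℝ) • ee n i} := by
  induction k with
  | zero => exact Finsupp.single_mem_supported _ _ (by simp)
  | succ k ih =>
    have h1 : cone (ee n k) (oct (ee n) k) ∈ Supp {l | l.length = k + 1 ∧
        ∃ s : Fin n → ℤˣ, ∀ x ∈ l, ∃ i : Fin n, (i : ℕ) < k + 1 ∧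
          x = ((s i : ℤ) : ℝ) • ee n i} := by
      refine cone_supp _ ?_ (ih (by omega))
      rintro l ⟨hl, s, hs⟩
      refine ⟨by simp [hl], Function.update s ⟨k, by omega⟩ 1, ?_⟩
      intro x hx
      rcases List.mem_cons.1 hx with rfl | hx
      · exact ⟨⟨k, by omega⟩, by simp, by simp⟩
      · obtain ⟨i, hi, rfl⟩ := hs x hx
        refine ⟨i, by omega, ?_⟩
        rw [Function.update_of_ne]
        intro h; rw [h] at hi; simp at hi
    rw [oct]
    refine Submodule.add_mem _ h1 (push_supp _ ?_ h1)
    rintro l ⟨hl, s, hs⟩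
    refine ⟨by simp [hl], -s, ?_⟩
    intro x hx
    obtain ⟨y, hy, rfl⟩ := List.mem_map.1 hx
    obtain ⟨i, hi, rfl⟩ := hs y hy
    exact ⟨i, hi, by simp⟩

lemma ee_face (n : ℕ) (s : Fin n → ℤˣ) (i : Fin n) : ((s i : ℤ) : ℝ) • ee n i ∈ face n s := by
  have h : ∀ j, ((s j : ℤ) : ℝ) * (((s i : ℤ) : ℝ) • ee n i) j = if j = i then 1 else 0 := by
    intro j
    by_cases hj : j = i
    · subst hj
      rcases Int.units_eq_one_or (s j) with h | h <;> simp [h, ee]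
    · simp [ee, hj, Fin.val_inj]
  refine ⟨fun j => ?_, ?_⟩
  · rw [h]; split_ifs <;> simp
  · simp_rw [h]; simp

lemma cone_oct_small (n k : ℕ) (hk : k < n) :
    cone (ee n k) (oct (ee n) k) ∈ Supp (Small (face n) (k + 1) 2) := by
  have h : ∀ l : List (Fin n → ℝ), (∃ s : Fin n → ℤˣ, ∀ x ∈ l, ∃ i : Fin n, (i : ℕ) < k + 1 ∧
      x = ((s i : ℤ) : ℝ) • ee n i) → l.length = k + 1 → l ∈ Small (face n) (k+1) 2 := by
    rintro l ⟨s, hs⟩ hl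
    have hf : ∀ x ∈ l, x ∈ face n s := by
      intro x hx
      obtain ⟨i, _, rfl⟩ := hs x hx
      exact ee_face n s i
    refine ⟨hl, ⟨s, hf⟩, fun x hx y hy => ?_⟩
    rw [dist_pi_le_iff (by norm_num)]
    intro i
    have h1 := octS_le (face_sub _ _ _ (hf x hx)) i
    have h2 := octS_le (face_sub _ _ _ (hf y hy)) i
    rw [Real.dist_eq]
    exact (abs_sub _ _).trans (by linarith)
  refine cone_supp _ ?_ (oct_supp n k hk.le)
  rintro l ⟨hl, s, hs⟩
  apply h
  · refine ⟨Function.update s ⟨k, by omega⟩ 1, ?_⟩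
    intro x hx
    rcases List.mem_cons.1 hx with rfl | hx
    · exact ⟨⟨k, by omega⟩, by simp, by simp⟩
    · obtain ⟨i, hi, rfl⟩ := hs x hx
      refine ⟨i, by omega, ?_⟩
      rw [Function.update_of_ne]
      intro h; rw [h] at hi; simp at hi
  · simp [hl]

lemma exists_odd_sign (V : Type*) [AddCommGroup V] [Module ℝ V] :
    ∃ τ : V → ZMod 2, ∀ x, x ≠ 0 → τ (-x) = τ x + 1 := by
  classical
  let _ : LinearOrder V := linearOrderOfSTO (WellOrderingRel (α := V))
  refine ⟨fun x => if x < -x then 1 else 0, fun x hx => ?_⟩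
  have hne : x ≠ -x := by
    intro h
    apply hx
    have : (2 : ℝ) • x = 0 := by rw [two_smul]; nth_rewrite 2 [h]; simp
    simpa using this
  simp only [neg_neg]
  rcases lt_or_gt_of_ne hne with h | h
  · rw [if_neg (not_lt.2 h.le), if_pos h]; decide
  · rw [if_pos h, if_neg (not_lt.2 h.le)]; decide

theorem borsuk_ulam (n : ℕ) (h : (Fin (n + 1) → ℝ) → (Fin n → ℝ))
    (hc : ContinuousOn h {0}ᶜ) (hodd : ∀ z, z ≠ 0 → h (-z) = - h z) :
    ∃ z, z ≠ 0 ∧ h z = 0 := by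
  classical
  by_contra hcon
  push Not at hcon
  have hcK : ContinuousOn h (octS (n+1)) := hc.mono (fun x hx => octS_ne hx)
  have hne : (octS (n+1)).Nonempty := ⟨ee (n+1) 0, by
    have := face_sub _ _ _ (ee_face (n+1) 1 0)
    simpa using this⟩
  obtain ⟨z0, hz0, hmin⟩ := (octS_compact (n+1)).exists_isMinOn hne hcK.norm
  set ε := ‖h z0‖ with hε
  have hεpos : 0 < ε := norm_pos_iff.2 (hcon z0 (octS_ne hz0))
  have huc := (octS_compact (n+1)).uniformContinuousOn_of_continuous hcK
  rw [Metric.uniformContinuousOn_iff] at huc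
  obtain ⟨δ, hδ, huc⟩ := huc (ε / 3) (by positivity)
  obtain ⟨j, hj⟩ : ∃ j : ℕ, ((n : ℝ) / (n + 1)) ^ j * 2 < δ := by
    obtain ⟨j, hj⟩ := exists_pow_lt_of_lt_one (show 0 < δ / 2 by positivity)
      (show (n : ℝ) / (n + 1) < 1 by rw [div_lt_one (by positivity)]; linarith)
    exact ⟨j, by linarith⟩
  obtain ⟨τ, hτ⟩ := exists_odd_sign (Fin (n+1) → ℝ)
  let s : ℕ → (Fin (n+1) → ℝ) → ZMod 2 := fun k x =>
    if hk : 1 ≤ k ∧ k ≤ n then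
      (if 0 < h x ⟨k - 1, by omega⟩ then 1 else if h x ⟨k - 1, by omega⟩ < 0 then 0 else τ x)
    else τ x
  have hs : ∀ x, x ≠ 0 → ∀ k, s k (-x) = s k x + 1 := by
    intro x hx k
    simp only [s]
    split_ifs with hk h1 h2 h3 h4 h5 h6 h7
    all_goals first
      | exact hτ x hx
      | (rw [hodd x hx] at *; simp only [Pi.neg_apply] at *; exfalso; linarith)
      | decide
  let c : ℕ → Ch (Fin (n+1) → ℝ) := fun k =>
    (sd bary (k+1))^[j] (cone (ee (n+1) k) (oct (ee (n+1)) k))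
  let z : ℕ → Ch (Fin (n+1) → ℝ) := fun k => (sd bary k)^[j] (oct (ee (n+1)) k)
  have hcs : ∀ k ≤ n, c k ∈ Supp (Small (face (n+1)) (k+1) ((n / (n + 1) : ℝ) ^ j * 2)) := by
    intro k hk
    exact sd_iter_small _ (face_convex (n+1)) n 2 (by norm_num) (k+1) (by omega) _
      (cone_oct_small (n+1) k (by omega)) j
  have hpush : ∀ (k : ℕ) (i : ℕ) (x : Ch (Fin (n+1) → ℝ)),
      push (fun x => -x) ((sd bary k)^[i] x) = (sd bary k)^[i] (push (fun x => -x) x) := by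
    intro k i
    induction i with
    | zero => intro x; rfl
    | succ i ih =>
      intro x
      rw [Function.iterate_succ_apply, ih, push_sd _ _ bary_neg, Function.iterate_succ_apply]
  have hbdi : ∀ (k : ℕ) (i : ℕ) (x : Ch (Fin (n+1) → ℝ)),
      bd ((sd bary (k+1))^[i] x) = (sd bary k)^[i] (bd x) := by
    intro k i
    induction i with
    | zero => intro x; rfl
    | succ i ih =>
      intro x
      rw [Function.iterate_succ_apply, ih, bd_sd, Function.iterate_succ_apply]
  have hadd : ∀ (k : ℕ) (i : ℕ) (x y : Ch (Fin (n+1) → ℝ)),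
      (sd bary k)^[i] (x + y) = (sd bary k)^[i] x + (sd bary k)^[i] y := by
    intro k i
    induction i with
    | zero => intro x y; rfl
    | succ i ih =>
      intro x y
      simp only [Function.iterate_succ_apply, map_add, ih]
  have hz : ∀ k, z (k+1) = c k + push (fun x => -x) (c k) := by
    intro k
    simp only [z, c, oct, hadd, hpush]
  have hp := parity s (fun x => -x) z c n ?_ hz ?_ ?_ (n+1) le_rfl
  · have hzs : z (n+1) ∈ Supp {l | l.length = n + 1 ∧ (∀ x ∈ l, x ∈ octS (n+1)) ∧
        ∀ x ∈ l, ∀ y ∈ l, dist x y < δ} := by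
      rw [hz]
      refine Submodule.add_mem _ (Finsupp.supported_mono ?_ (hcs n le_rfl))
        (push_supp _ ?_ (hcs n le_rfl))
      · rintro l ⟨h1, ⟨i, h2⟩, h3⟩
        exact ⟨h1, fun x hx => face_sub _ i _ (h2 x hx), fun x hx y hy => (h3 x hx y hy).trans_lt hj⟩
      · rintro l ⟨h1, ⟨i, h2⟩, h3⟩
        refine ⟨by simp [h1], fun x hx => ?_, fun x hx y hy => ?_⟩
        · obtain ⟨x', hx', rfl⟩ := List.mem_map.1 hx
          have := face_sub _ i _ (h2 x' hx')
          simpa [octS] using this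
        · obtain ⟨x', hx', rfl⟩ := List.mem_map.1 hx
          obtain ⟨y', hy', rfl⟩ := List.mem_map.1 hy
          rw [dist_neg_neg]
          exact (h3 x' hx' y' hy').trans_lt hj
    have h0 : ev (alp s) (z (n+1)) = ev (fun _ => 0) (z (n+1)) := by
      apply ev_congr _ hzs
      rintro l ⟨h1, h2, h3⟩
      by_contra hl
      have hb : bet s l ≠ 0 := by
        cases l with
        | nil => simp at h1
        | cons x l => exact right_ne_zero_of_mul hl
      obtain ⟨x0, hx0⟩ : ∃ x0, x0 ∈ l := List.exists_mem_of_length_pos (by omega)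
      have hle : ‖h x0‖ ≤ 2 * (ε / 3) := by
        rw [pi_norm_le_iff_of_nonneg (by positivity)]
        intro i
        obtain ⟨x, hx, y, hy, hxy⟩ := bet_ne s l hb (i + 1) (by omega) (by omega)
        have hd : ∀ a ∈ l, ∀ b ∈ l, |h a i - h b i| ≤ ε / 3 := by
          intro a ha b hb
          have h4 := huc a (h2 a ha) b (h2 b hb) (h3 a ha b hb)
          have h5 := dist_le_pi_dist (h a) (h b) i
          rw [Real.dist_eq] at h5
          linarith
        have e1 := abs_le.1 (hd x hx y hy)
        have e2 := abs_le.1 (hd x0 hx0 x hx)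
        have e3 := abs_le.1 (hd x0 hx0 y hy)
        have hi : 1 ≤ (i : ℕ) + 1 ∧ (i : ℕ) + 1 ≤ n := ⟨by omega, by omega⟩
        simp only [s, dif_pos hi, Nat.add_sub_cancel, Fin.eta] at hxy
        have e4 : (h x i ≤ 0 ∧ 0 ≤ h y i) ∨ (h y i ≤ 0 ∧ 0 ≤ h x i) := by
          by_contra hcc
          push Not at hcc
          apply hxy
          rcases lt_trichotomy (h x i) 0 with hx1 | hx1 | hx1
          · have : h y i < 0 := hcc.1 hx1.le
            rw [if_neg (by linarith), if_pos hx1, if_neg (by linarith), if_pos this]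
          · have := hcc.1 hx1.le
            have := hcc.2 this.le
            linarith
          · have : 0 < h y i := by
              by_contra h'
              have := hcc.2 (not_lt.1 h')
              linarith
            rw [if_pos hx1, if_pos this]
        rw [Real.norm_eq_abs, abs_le]
        rcases e4 with ⟨e4, e5⟩ | ⟨e4, e5⟩ <;> constructor <;> linarith
      have := hmin (h2 x0 hx0)
      simp only [Set.mem_ofPred_eq] at this
      linarith
    rw [h0] at hp
    have : ev (fun _ => 0) (z (n+1)) = 0 := by
      have := ev_smul (fun _ => 0) 0 (z (n+1))
      simpa using this
    rw [this] at hp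
    exact absurd hp (by decide)
  · have : ∀ i, (sd (bary (V := Fin (n+1) → ℝ)) 0)^[i] (Finsupp.single [] 1) =
        Finsupp.single [] 1 := by
      intro i
      induction i with
      | zero => rfl
      | succ i ih => rw [Function.iterate_succ_apply', ih]; rfl
    exact this j
  · intro k
    simp only [z, c, hbdi, bd_cone_oct]
  · intro k hk
    refine Finsupp.supported_mono ?_ (hcs k hk)
    rintro l ⟨h1, ⟨i, h2⟩, h3⟩
    refine ⟨by rintro rfl; simp at h1, fun x hx => hs x (octS_ne (face_sub _ i _ (h2 x hx)))⟩

end BU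

end PosetBU
namespace PosetBU
open CategoryTheory

section Realization

/-- barycentric coordinates with support a chain -/
def Bar (P : Type) [PartialOrder P] [Fintype P] : Type :=
  {v : stdSimplex ℝ P // ∀ x y, v x ≠ 0 → v y ≠ 0 → x ≤ y ∨ y ≤ x}

instance (P : Type) [PartialOrder P] [Fintype P] : TopologicalSpace (Bar P) :=
  inferInstanceAs (TopologicalSpace (Subtype _))

lemma stdSimplex_map_apply {X Y : Type} [Fintype X] [Fintype Y] (f : X → Y)
    (v : stdSimplex ℝ X) (y : Y) [DecidableEq Y] :
    stdSimplex.map f v y = ∑ x, if f x = y then v x else 0 := by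
  rw [stdSimplex.map_coe, FunOnFinite.linearMap_apply_apply, Finset.sum_filter]

lemma stdSimplex_map_ne {X Y : Type} [Fintype X] [Fintype Y] (f : X → Y)
    (v : stdSimplex ℝ X) (y : Y) (h : stdSimplex.map f v y ≠ 0) : ∃ x, f x = y ∧ v x ≠ 0 := by
  classical
  rw [stdSimplex_map_apply] at h
  obtain ⟨x, _, hx⟩ := Finset.exists_ne_zero_of_sum_ne_zero h
  refine ⟨x, ?_, ?_⟩
  · by_contra h'; simp [h'] at hx
  · intro h'; simp [h'] at hx

variable {P Q : Type} [PartialOrder P] [PartialOrder Q] [Fintype P] [Fintype Q]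

lemma map_chain (f : P → Q) (hf : Monotone f) (v : stdSimplex ℝ P)
    (hv : ∀ x y, v x ≠ 0 → v y ≠ 0 → x ≤ y ∨ y ≤ x) (x y : Q)
    (hx : stdSimplex.map f v x ≠ 0) (hy : stdSimplex.map f v y ≠ 0) : x ≤ y ∨ y ≤ x := by
  obtain ⟨a, rfl, ha⟩ := stdSimplex_map_ne f _ _ hx
  obtain ⟨b, rfl, hb⟩ := stdSimplex_map_ne f _ _ hy
  exact (hv a b ha hb).imp (fun h => hf h) (fun h => hf h)

noncomputable def Bar.map (f : P → Q) (hf : Monotone f) : C(Bar P, Bar Q) where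
  toFun v := ⟨stdSimplex.map f v.1, map_chain f hf v.1 v.2⟩
  continuous_toFun := Continuous.subtype_mk
    ((stdSimplex.continuous_map f).comp continuous_subtype_val) _

/-- characteristic map of a chain -/
noncomputable def chi {n : ℕ} (c : Fin (n+1) → P) (hc : Monotone c) :
    C(stdSimplex ℝ (Fin (n+1)), Bar P) where
  toFun v := ⟨stdSimplex.map c v, map_chain c hc v (fun x y _ _ => le_total x y)⟩
  continuous_toFun := Continuous.subtype_mk (stdSimplex.continuous_map c) _

noncomputable def barS (P : Type) [PartialOrder P] [Fintype P] :
    nerve P ⟶ TopCat.toSSet.obj (TopCat.of (Bar P)) where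
  app n := TypeCat.ofHom (fun c => ((TopCat.of (Bar P)).toSSetObjEquiv n).symm
    (chi (fun i => c.obj i) (fun i j h => leOfHom (c.map (homOfLE h)))))
  naturality := by
    intro m n f
    ext c
    have h := TopCat.toSSetObjEquiv_symm_naturality (X := TopCat.of (Bar P)) f.unop
      (chi (fun i => c.obj i) (fun i j h => leOfHom (c.map (homOfLE h))))
    refine Eq.trans ?_ h.symm
    apply congrArg ((TopCat.of (Bar P)).toSSetObjEquiv n).symm
    ext v
    apply Subtype.ext
    exact (stdSimplex.map_comp_apply f.unop (fun i => c.obj i) v).symm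

noncomputable def bar (P : Type) [PartialOrder P] [Fintype P] :
    SSet.toTop.obj (nerve P) ⟶ TopCat.of (Bar P) :=
  (sSetTopAdj.homEquiv _ _).symm (barS P)

noncomputable def nmap (f : P → Q) (hf : Monotone f) : nerve P ⟶ nerve Q :=
  nerveMap hf.functor

noncomputable def rmap (f : P → Q) (hf : Monotone f) :
    SSet.toTop.obj (nerve P) ⟶ SSet.toTop.obj (nerve Q) := SSet.toTop.map (nmap f hf)

lemma bar_nat (f : P → Q) (hf : Monotone f) :
    rmap f hf ≫ bar Q = bar P ≫ TopCat.ofHom (Bar.map f hf) := by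
  apply (sSetTopAdj.homEquiv _ _).injective
  rw [rmap, bar, bar, Adjunction.homEquiv_naturality_left, Adjunction.homEquiv_naturality_right]
  simp only [Equiv.apply_symm_apply]
  ext n c
  refine Eq.trans (b := ((TopCat.of (Bar Q)).toSSetObjEquiv n).symm
    ((Bar.map f hf).comp
      (chi (fun i => c.obj i) (fun i j h => leOfHom (c.map (homOfLE h)))))) ?_ rfl
  apply congrArg ((TopCat.of (Bar Q)).toSSetObjEquiv n).symm
  ext v
  apply Subtype.ext
  exact (stdSimplex.map_comp_apply (fun i => c.obj i) f v).symm

lemma bar_nat_apply (f : P → Q) (hf : Monotone f) (x : SSet.toTop.obj (nerve P)) :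
    bar Q (rmap f hf x) = Bar.map f hf (bar P x) :=
  ConcreteCategory.congr_hom (bar_nat f hf) x

noncomputable def cell {n : ℕ} (c : Fin (n+1) → P) (hc : Monotone c) :
    C(stdSimplex ℝ (Fin (n+1)), SSet.toTop.obj (nerve P)) :=
  (SSet.toTop.obj (nerve P)).toSSetObjEquiv (Opposite.op (SimplexCategory.mk n))
    ((sSetTopAdj.unit.app (nerve P)).app (Opposite.op (SimplexCategory.mk n)) hc.functor)

lemma bar_cell {n : ℕ} (c : Fin (n+1) → P) (hc : Monotone c) (v : stdSimplex ℝ (Fin (n+1))) :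
    bar P (cell c hc v) = chi c hc v := by
  have h1 : sSetTopAdj.unit.app (nerve P) ≫ TopCat.toSSet.map (bar P) = barS P :=
    (sSetTopAdj.homEquiv_unit (X := nerve P) (f := bar P)).symm.trans
      (Equiv.apply_symm_apply _ _)
  have h2 := ConcreteCategory.congr_hom
    (NatTrans.congr_app h1 (Opposite.op (SimplexCategory.mk n))) hc.functor
  have h3 := congrArg ((TopCat.of (Bar P)).toSSetObjEquiv
    (Opposite.op (SimplexCategory.mk n))) h2
  exact DFunLike.congr_fun h3 v

lemma rmap_comp {P Q R : Type} [PartialOrder P] [PartialOrder Q] [PartialOrder R] (f : P → Q) (hf : Monotone f)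
    (g : Q → R) (hg : Monotone g) (x : SSet.toTop.obj (nerve P)) :
    rmap g hg (rmap f hf x) = rmap (g ∘ f) (hg.comp hf) x := by
  have : rmap f hf ≫ rmap g hg = rmap (g ∘ f) (hg.comp hf) := by
    rw [rmap, rmap, ← Functor.map_comp]; rfl
  exact ConcreteCategory.congr_hom this x

lemma rmap_id {P : Type} [PartialOrder P] (f : P → P) (hf : Monotone f) (h : ∀ x, f x = x) (x : SSet.toTop.obj (nerve P)) :
    rmap f hf x = x := by
  obtain rfl : f = id := funext h
  have : rmap id hf = 𝟙 (SSet.toTop.obj (nerve P)) := by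
    exact CategoryTheory.Functor.map_id SSet.toTop (nerve P)
  exact ConcreteCategory.congr_hom this x

lemma chi_injective {n : ℕ} (c : Fin (n+1) → P) (hc : Monotone c) (hi : Function.Injective c) :
    Function.Injective (chi c hc) := by
  classical
  intro v w h
  have h1 : stdSimplex.map c v = stdSimplex.map c w := congrArg Subtype.val h
  ext i
  have h2 := DFunLike.congr_fun h1 (c i)
  rw [stdSimplex_map_apply, stdSimplex_map_apply] at h2
  simpa [hi.eq_iff] using h2

lemma cell_injective {n : ℕ} (c : Fin (n+1) → P) (hc : Monotone c) (hi : Function.Injective c) :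
    Function.Injective (cell c hc) := by
  intro v w h
  apply chi_injective c hc hi
  rw [← bar_cell, ← bar_cell, h]

lemma bar_map_neg (ν : P → P) (hν : Monotone ν) (hinv : ∀ x, ν (ν x) = x) (v : Bar P) (p : P) :
    (Bar.map ν hν v).1 p = v.1 (ν p) := by
  classical
  change stdSimplex.map ν v.1 p = _
  rw [stdSimplex_map_apply, Finset.sum_eq_single (ν p)]
  · simp [hinv]
  · intro b _ hb
    rw [if_neg]
    rintro rfl
    exact hb (hinv b).symm
  · simp

lemma exists_sign (ν : P → P) (hinv : ∀ x, ν (ν x) = x) (hfree : ∀ x, ν x ≠ x) :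
    ∃ σ : P → ℝ, (∀ x, σ (ν x) = - σ x) ∧ ∀ x, σ x ≠ 0 := by
  classical
  let e := Fintype.equivFin P
  refine ⟨fun x => if e x < e (ν x) then 1 else -1, fun x => ?_, fun x => by beta_reduce; split_ifs <;> simp⟩
  have hne : e x ≠ e (ν x) := fun h => hfree x (e.injective h).symm
  simp only [hinv]
  rcases lt_or_gt_of_ne hne with h | h
  · rw [if_neg (not_lt.2 h.le), if_pos h]
  · rw [if_pos h, if_neg (not_lt.2 h.le)]; simp

lemma exists_odd_map (d : ℕ) (ν : Q → Q) (hν : Monotone ν) (hinv : ∀ x, ν (ν x) = x)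
    (hfree : ∀ x, ν x ≠ x) (hdim : ∀ p : LTSeries Q, p.length < d) :
    ∃ g : SSet.toTop.obj (nerve Q) → (Fin d → ℝ), Continuous g ∧
      (∀ x, g (rmap ν hν x) = - g x) ∧ ∀ x, g x ≠ 0 := by
  classical
  obtain ⟨σ, hσ, hσ0⟩ := exists_sign ν hinv hfree
  have hfin : ∀ q : Q, Order.height q < d := by
    intro q
    rcases Nat.eq_zero_or_pos d with rfl | hd
    · exact absurd (hdim (RelSeries.singleton _ q)) (by simp)
    have : Order.height q ≤ ((d - 1 : ℕ) : ℕ∞) := by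
      apply Order.height_le
      intro p _
      have := hdim p
      exact_mod_cast (by omega : p.length ≤ d - 1)
    refine this.trans_lt ?_
    exact_mod_cast (by omega : d - 1 < d)
  let e : Q ≃o Q :=
    { toFun := ν, invFun := ν, left_inv := hinv, right_inv := hinv,
      map_rel_iff' := by
        intro a b
        refine ⟨fun h => ?_, fun h => hν h⟩
        have := hν h
        change ν (ν a) ≤ ν (ν b) at this
        rwa [hinv, hinv] at this }
  have hht : ∀ q, Order.height (ν q) = Order.height q := fun q => Order.height_orderIso e q
  have hlt : ∀ a b : Q, a < b → Order.height a < Order.height b := by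
    intro a b hab
    apply Order.height_strictMono hab
    exact (hfin a).trans (by simp)
  let g : SSet.toTop.obj (nerve Q) → (Fin d → ℝ) := fun x i =>
    ∑ q, if Order.height q = ((i : ℕ) : ℕ∞) then σ q * (bar Q x).1 q else 0
  refine ⟨g, ?_, ?_, ?_⟩
  · apply continuous_pi
    intro i
    apply continuous_finsetSum
    intro q _
    split_ifs
    · apply continuous_const.mul
      have h1 : Continuous (fun x : SSet.toTop.obj (nerve Q) => (bar Q x : Bar Q)) :=
        (bar Q).hom.continuous
      have h2 : Continuous (fun v : Bar Q => (v.1.1 q : ℝ)) :=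
        (continuous_apply q).comp (continuous_subtype_val.comp continuous_subtype_val)
      exact h2.comp h1
    · exact continuous_const
  · intro x
    funext i
    simp only [g, Pi.neg_apply]
    rw [← Finset.sum_neg_distrib, ← Equiv.sum_comp e.toEquiv]
    apply Finset.sum_congr rfl
    intro q _
    have h1 : (bar Q (rmap ν hν x)).1 (ν q) = (bar Q x).1 q := by
      rw [bar_nat_apply, bar_map_neg ν hν hinv, hinv]
    change (if Order.height (ν q) = _ then σ (ν q) * (bar Q (rmap ν hν x)).1 (ν q) else 0) = _
    rw [hht, h1, hσ]
    split_ifs <;> simp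
  · intro x hx
    have hsum : ∑ q, (bar Q x).1 q = 1 := (bar Q x).1.2.2
    obtain ⟨q, _, hq⟩ := Finset.exists_ne_zero_of_sum_ne_zero (by rw [hsum]; exact one_ne_zero)
    obtain ⟨m, hm⟩ := ENat.ne_top_iff_exists.1 ((hfin q).trans (by simp)).ne
    have hmd : m < d := by have := hfin q; rw [← hm] at this; exact_mod_cast this
    have h1 := congrFun hx ⟨m, hmd⟩
    simp only [g, Pi.zero_apply] at h1
    rw [Finset.sum_eq_single q] at h1
    · rw [if_pos hm.symm] at h1
      exact mul_ne_zero (hσ0 q) hq h1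
    · intro b _ hb
      split_ifs with h2
      · by_contra h3
        have h4 : (bar Q x).1 b ≠ 0 := right_ne_zero_of_mul h3
        rcases (bar Q x).2 b q h4 hq with h5 | h5
        · have := hlt b q (lt_of_le_of_ne h5 hb)
          rw [h2, ← hm] at this; exact lt_irrefl _ this
        · have := hlt q b (lt_of_le_of_ne h5 hb.symm)
          rw [h2, ← hm] at this; exact lt_irrefl _ this
      · rfl
    · simp

/-- A missed vertex gives a missed point. -/
lemma exists_missed (φ : P → Q) (hφ : Monotone φ) (q : Q) (hq : ∀ p, φ p ≠ q) :
    ∃ y : SSet.toTop.obj (nerve Q), ∀ x, rmap φ hφ x ≠ y := by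
  classical
  have hc : Monotone (fun _ : Fin (0+1) => q) := monotone_const
  refine ⟨cell (fun _ : Fin (0+1) => q) hc (stdSimplex.vertex 0), fun x hx => ?_⟩
  have h1 : (bar Q (rmap φ hφ x)).1 q =
      (bar Q (cell (fun _ : Fin (0+1) => q) hc (stdSimplex.vertex 0))).1 q := by rw [hx]
  rw [bar_nat_apply, bar_cell] at h1
  change stdSimplex.map φ (bar P x).1 q =
    stdSimplex.map (fun _ : Fin (0+1) => q) (stdSimplex.vertex 0) q at h1
  rw [stdSimplex_map_apply, stdSimplex_map_apply] at h1
  simp [hq] at h1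

end Realization
end PosetBU
namespace PosetBU
section Topo
open Set Metric

lemma norm_inv_smul_mem {E : Type} [NormedAddCommGroup E] [NormedSpace ℝ E] {z : E} (hz : z ≠ 0) : ‖z‖⁻¹ • z ∈ sphere (0 : E) 1 := by
  rw [mem_sphere_zero_iff_norm, norm_smul, norm_inv, norm_norm,
    inv_mul_cancel₀ (norm_ne_zero_iff.2 hz)]

variable {E W : Type} [NormedAddCommGroup E] [NormedSpace ℝ E] [FiniteDimensional ℝ E]
  [NormedAddCommGroup W] [NormedSpace ℝ W]

lemma hext_continuous (f : E → W) (hf : ContinuousOn f (sphere 0 1)) :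
    Continuous (fun z : E => ‖z‖ • f (‖z‖⁻¹ • z)) := by
  have hprop : ProperSpace E := FiniteDimensional.proper ℝ E
  rw [continuous_iff_continuousAt]
  intro z
  by_cases hz : z = 0
  · subst hz
    obtain ⟨C, hC⟩ := (isCompact_sphere (0 : E) 1).exists_bound_of_continuousOn hf
    have h0 : Filter.Tendsto (fun z : E => ‖z‖ * C) (nhds 0) (nhds 0) := by
      have : Continuous (fun z : E => ‖z‖ * C) := by fun_prop
      simpa using this.tendsto 0
    rw [ContinuousAt]
    simp only [norm_zero, zero_smul]
    refine squeeze_zero_norm (fun x => ?_) h0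
    by_cases hx : x = 0
    · simp [hx]
    · rw [norm_smul, norm_norm]
      exact mul_le_mul_of_nonneg_left (hC _ (norm_inv_smul_mem hx)) (norm_nonneg _)
  · have h1 : ContinuousOn (fun z : E => ‖z‖⁻¹ • z) {0}ᶜ := by
      refine ContinuousOn.smul (ContinuousOn.inv₀ (by fun_prop) ?_) continuousOn_id
      intro x hx
      exact norm_ne_zero_iff.2 hx
    have h2 : ContinuousOn (fun z : E => ‖z‖ • f (‖z‖⁻¹ • z)) {0}ᶜ :=
      ContinuousOn.smul (by fun_prop)
        (hf.comp h1 (fun x hx => norm_inv_smul_mem hx))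
    exact h2.continuousAt (isOpen_compl_singleton.mem_nhds hz)

lemma null_ext (G p : E → W) (hG : ContinuousOn G (sphere 0 1)) (hp : ContinuousOn p (sphere 0 1))
    (hG1 : ∀ x ∈ sphere (0 : E) 1, ‖G x‖ = 1) (hpG : ∀ x ∈ sphere (0 : E) 1, ‖p x - G x‖ < 1)
    (y : W) (hy0 : y ≠ 0) (hy : ∀ x ∈ sphere (0 : E) 1, ∀ s : ℝ, 0 < s → s • p x ≠ y) :
    ∃ F : E → W, Continuous F ∧ (∀ z, ‖F z‖ = 1) ∧ ∀ x ∈ sphere (0 : E) 1, F x = G x := by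
  set ψ : E → W := fun z => (max 0 (2 * ‖z‖ - 1)) • (‖z‖ • G (‖z‖⁻¹ • z)) +
    (max 0 (min ‖z‖ (1 - ‖z‖))) • (‖z‖ • p (‖z‖⁻¹ • z)) - (max 0 (1 - 2 * ‖z‖)) • y with hψ
  have hc : Continuous ψ := by
    have a1 := hext_continuous G hG
    have a2 := hext_continuous p hp
    refine Continuous.sub (Continuous.add (Continuous.smul (by fun_prop) a1)
      (Continuous.smul (by fun_prop) a2)) (Continuous.smul (by fun_prop) continuous_const)
  have hne : ∀ z, ψ z ≠ 0 := by
    intro z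
    by_cases hz : z = 0
    · simp [hψ, hz, hy0]
    have hS := norm_inv_smul_mem hz
    have hr : 0 < ‖z‖ := norm_pos_iff.2 hz
    set x := ‖z‖⁻¹ • z with hx
    set r := ‖z‖ with hrdef
    simp only [hψ]
    rw [← hrdef, ← hx]
    rcases le_or_gt (1/2) r with h | h
    · rw [max_eq_left (a := (0:ℝ)) (b := 1 - 2 * r) (by linarith),
        max_eq_right (a := (0:ℝ)) (b := 2 * r - 1) (by linarith), zero_smul, sub_zero,
        smul_smul, smul_smul]
      set b := max 0 (min r (1 - r)) with hb
      have hb0 : 0 ≤ b := le_max_left _ _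
      have hab : 0 < (2 * r - 1) * r + b * r := by
        rcases h.lt_or_eq with h' | h'
        · have : 0 < (2 * r - 1) * r := mul_pos (by linarith) hr
          positivity
        · have : b = 1 / 2 := by rw [hb, ← h']; norm_num
          rw [this, ← h']; norm_num
      intro h0
      have e : ((2 * r - 1) * r + b * r) • G x = - ((b * r) • (p x - G x)) := by
        rw [smul_sub, add_smul, neg_sub, ← sub_eq_zero, ← h0]
        abel
      have e2 := congrArg norm e
      rw [norm_neg, norm_smul, norm_smul, hG1 x hS, Real.norm_of_nonneg hab.le,
        Real.norm_of_nonneg (by positivity), mul_one] at e2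
      have h3 := hpG x hS
      have h4 : 0 ≤ (2 * r - 1) * r := mul_nonneg (by linarith) hr.le
      rcases (mul_nonneg hb0 hr.le).lt_or_eq with h5 | h5
      · have := mul_lt_mul_of_pos_left h3 h5
        linarith
      · rw [← h5] at e2 hab
        linarith
    · rw [max_eq_left (a := (0:ℝ)) (b := 2 * r - 1) (by linarith),
        max_eq_right (a := (0:ℝ)) (b := 1 - 2 * r) (by linarith), zero_smul, zero_add,
        min_eq_left (by linarith), max_eq_right hr.le]
      intro h0
      have hpos : 0 < 1 - 2 * r := by linarith
      refine hy x hS ((1 - 2 * r)⁻¹ * (r * r)) (by positivity) ?_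
      rw [mul_smul, mul_smul, sub_eq_zero.1 h0, inv_smul_smul₀ hpos.ne']
  refine ⟨fun z => ‖ψ z‖⁻¹ • ψ z, ?_, ?_, ?_⟩
  · exact Continuous.smul (Continuous.inv₀ hc.norm (fun z => norm_ne_zero_iff.2 (hne z))) hc
  · intro z
    exact mem_sphere_zero_iff_norm.1 (norm_inv_smul_mem (hne z))
  · intro x hx
    have hx1 : ‖x‖ = 1 := mem_sphere_zero_iff_norm.1 hx
    have : ψ x = G x := by
      simp only [hψ, hx1]
      norm_num
    simp only [this, hG1 x hx]
    simp

lemma missing_dir {k d : ℕ} (hk : k + 1 < d) (p : (Fin (k+1) → ℝ) → EuclideanSpace ℝ (Fin d))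
    (hp : ContDiff ℝ 1 p) : ∃ y, y ≠ 0 ∧ ∀ x ∈ sphere (0 : Fin (k+1) → ℝ) 1, ∀ s : ℝ, 0 < s →
      s • p x ≠ y := by
  let m : Fin (k+1) × Bool → (Fin (k+1) → ℝ) → EuclideanSpace ℝ (Fin d) :=
    fun a z => z a.1 • p (Function.update z a.1 (if a.2 then 1 else -1))
  have hm : ∀ a, ContDiff ℝ 1 (m a) := by
    intro a
    have hu : ContDiff ℝ 1 (fun z : Fin (k+1) → ℝ =>
        Function.update z a.1 (if a.2 then (1:ℝ) else -1)) := by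
      rw [contDiff_pi]
      intro j
      by_cases hj : j = a.1
      · subst hj
        simp only [Function.update_self]
        exact contDiff_const
      · simp only [Function.update_of_ne hj]
        exact contDiff_apply ℝ ℝ j
    exact (contDiff_apply ℝ ℝ a.1).smul (hp.comp hu)
  have hdim : dimH (⋃ a, range (m a)) < Module.finrank ℝ (EuclideanSpace ℝ (Fin d)) := by
    rw [dimH_iUnion]
    have : (⨆ a, dimH (range (m a))) ≤ ((k + 1 : ℕ) : ENNReal) := by
      refine iSup_le fun a => ?_
      simpa using (hm a).dimH_range_le
    refine this.trans_lt ?_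
    rw [finrank_euclideanSpace_fin]
    exact_mod_cast hk
  obtain ⟨y, hy⟩ := (dense_compl_of_dimH_lt_finrank hdim).nonempty
  rw [mem_compl_iff, mem_iUnion, not_exists] at hy
  refine ⟨y, ?_, ?_⟩
  · rintro rfl
    exact hy (0, true) ⟨0, by simp [m]⟩
  · intro x hx s hs hxy
    have hx1 : ‖x‖ = 1 := mem_sphere_zero_iff_norm.1 hx
    obtain ⟨i, hi⟩ : ∃ i, ‖x i‖ = 1 := by
      by_contra hcon
      push Not at hcon
      have : ‖x‖ < 1 := (pi_norm_lt_iff one_pos).2 fun i =>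
        lt_of_le_of_ne (hx1 ▸ norm_le_pi_norm x i) (hcon i)
      linarith
    rw [Real.norm_eq_abs] at hi
    have : ∃ b : Bool, x i = if b then 1 else -1 := by
      rcases eq_or_eq_neg_of_abs_eq hi with h | h
      · exact ⟨true, by simpa using h⟩
      · exact ⟨false, by simpa using h⟩
    obtain ⟨b, hb⟩ := this
    refine hy (i, b) ⟨Function.update x i s, ?_⟩
    simp only [m, Function.update_self, Function.update_idem]
    rw [← hb, Function.update_eq_self, hxy]

lemma exists_approx (G : E → W) (hG : ContinuousOn G (sphere 0 1)) [CompleteSpace W] :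
    ∃ p : E → W, ContDiff ℝ 1 p ∧ ∀ x ∈ sphere (0 : E) 1, ‖p x - G x‖ < 1 := by
  have hprop : ProperSpace E := FiniteDimensional.proper ℝ E
  have hc := hext_continuous G hG
  set f := fun z : E => ‖z‖ • G (‖z‖⁻¹ • z) with hf
  have hu : UniformContinuousOn f (closedBall 0 2) :=
    (isCompact_closedBall 0 2).uniformContinuousOn_of_continuous hc.continuousOn
  obtain ⟨δ, hδ, h⟩ := Metric.uniformContinuousOn_iff.mp hu (1/2) (by norm_num)
  obtain ⟨g, hg, hgd⟩ := hc.exists_contDiff_dist_le_of_forall_mem_ball_dist_le (lt_min one_pos hδ)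
  refine ⟨g, hg.of_le (by exact_mod_cast le_top), fun x hx => ?_⟩
  have hx1 : ‖x‖ = 1 := mem_sphere_zero_iff_norm.1 hx
  have h1 : dist (g x) (f x) ≤ 1/2 := by
    refine hgd x _ fun y hy => ?_
    rw [mem_ball, lt_min_iff] at hy
    refine (h y ?_ x ?_ hy.2).le
    · rw [mem_closedBall_zero_iff]
      have := norm_le_norm_add_norm_sub' y x
      rw [← dist_eq_norm] at this
      linarith [hy.1]
    · rw [mem_closedBall_zero_iff]; linarith
  have h2 : f x = G x := by simp [hf, hx1]
  rw [h2, dist_eq_norm] at h1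
  linarith

lemma ext_sphere {k d : ℕ} {X : Type} [TopologicalSpace X]
    (e : X ≃ₜ sphere (0 : EuclideanSpace ℝ (Fin d)) 1)
    (G : (Fin (k+1) → ℝ) → X) (hG : ContinuousOn G {0}ᶜ)
    (h : k + 1 < d ∨ ∃ y, ∀ z, z ≠ 0 → G z ≠ y) :
    ∃ F : (Fin (k+1) → ℝ) → X, Continuous F ∧ ∀ x ∈ sphere (0 : Fin (k+1) → ℝ) 1, F x = G x := by
  have hsub : sphere (0 : Fin (k+1) → ℝ) 1 ⊆ {0}ᶜ := by
    intro x hx h0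
    simp only [mem_singleton_iff] at h0
    simp [h0] at hx
  set G' : (Fin (k+1) → ℝ) → EuclideanSpace ℝ (Fin d) := fun z => (e (G z) : _) with hG'
  have hG'c : ContinuousOn G' (sphere 0 1) :=
    (continuous_subtype_val.comp e.continuous).comp_continuousOn (hG.mono hsub)
  have hG1 : ∀ x ∈ sphere (0 : Fin (k+1) → ℝ) 1, ‖G' x‖ = 1 := fun x _ =>
    mem_sphere_zero_iff_norm.1 (e (G x)).2
  have key : ∃ F : (Fin (k+1) → ℝ) → EuclideanSpace ℝ (Fin d), Continuous F ∧
      (∀ z, ‖F z‖ = 1) ∧ ∀ x ∈ sphere (0 : Fin (k+1) → ℝ) 1, F x = G' x := by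
    rcases h with h | ⟨y, hy⟩
    · obtain ⟨p, hp, hpG⟩ := exists_approx G' hG'c
      obtain ⟨y, hy0, hy⟩ := missing_dir h p hp
      exact null_ext G' p hG'c hp.continuous.continuousOn hG1 hpG y hy0 hy
    · have hy1 : ‖(e y : EuclideanSpace ℝ (Fin d))‖ = 1 := mem_sphere_zero_iff_norm.1 (e y).2
      refine null_ext G' G' hG'c hG'c hG1 (by simp) (e y : EuclideanSpace ℝ (Fin d)) ?_ ?_
      · intro h0; rw [h0] at hy1; simp at hy1
      · intro x hx s hs hsy
        have := congrArg norm hsy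
        rw [norm_smul, hG1 x hx, hy1, Real.norm_of_nonneg hs.le, mul_one] at this
        rw [this, one_smul] at hsy
        exact hy x (hsub hx) (e.injective (Subtype.ext hsy))
  obtain ⟨F, hF, hF1, hFG⟩ := key
  refine ⟨fun z => e.symm ⟨F z, mem_sphere_zero_iff_norm.2 (hF1 z)⟩, ?_, ?_⟩
  · exact e.symm.continuous.comp (hF.subtype_mk _)
  · intro x hx
    rw [Homeomorph.symm_apply_eq]
    exact Subtype.ext (hFG x hx)

/-- equivariant maps from the `k`-sphere. -/
def HasOdd (k : ℕ) (X : Type) [TopologicalSpace X] (ν : X → X) : Prop :=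
  ∃ G : (Fin (k+1) → ℝ) → X, ContinuousOn G {0}ᶜ ∧ ∀ z, z ≠ 0 → G (-z) = ν (G z)

lemma init_norm_max {k : ℕ} (z : Fin (k+1+1) → ℝ) :
    max ‖(Fin.init z : Fin (k+1) → ℝ)‖ |z (Fin.last _)| = ‖z‖ := by
  apply le_antisymm
  · refine max_le ((pi_norm_le_iff_of_nonneg (norm_nonneg _)).2 fun i => ?_) ?_
    · exact norm_le_pi_norm z i.castSucc
    · exact norm_le_pi_norm z (Fin.last _)
  · refine (pi_norm_le_iff_of_nonneg (le_max_of_le_left (norm_nonneg _))).2 fun i => ?_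
    refine Fin.lastCases ?_ (fun j => ?_) i
    · exact le_max_right _ _
    · exact le_max_of_le_left (norm_le_pi_norm (Fin.init z : Fin (k+1) → ℝ) j)

lemma hasOdd_step {k : ℕ} {X : Type} [TopologicalSpace X] (ν : X → X) (hν : Continuous ν)
    (hinv : ∀ x, ν (ν x) = x)
    (G : (Fin (k+1) → ℝ) → X) (hodd : ∀ z, z ≠ 0 → G (-z) = ν (G z))
    (F : (Fin (k+1) → ℝ) → X) (hF : Continuous F)
    (hFG : ∀ x ∈ sphere (0 : Fin (k+1) → ℝ) 1, F x = G x) : HasOdd (k+1) X ν := by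
  have hFodd : ∀ x ∈ sphere (0 : Fin (k+1) → ℝ) 1, F x = ν (F (-x)) := by
    intro x hx
    have hx' : -x ∈ sphere (0 : Fin (k+1) → ℝ) 1 := by simpa using hx
    have h0 : x ≠ 0 := by rintro rfl; simp at hx
    rw [hFG x hx, hFG _ hx', hodd x h0, hinv]
  have hn : ∀ z : Fin (k+1+1) → ℝ, z ≠ 0 → z (Fin.last _) = 0 →
      ‖z‖⁻¹ • (Fin.init z : Fin (k+1) → ℝ) ∈ sphere (0 : Fin (k+1) → ℝ) 1 := by
    intro z hz h0
    have := init_norm_max z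
    rw [h0, abs_zero, max_eq_left (norm_nonneg _)] at this
    rw [← this]
    apply norm_inv_smul_mem
    rw [← norm_ne_zero_iff, this]
    exact norm_ne_zero_iff.2 hz
  refine ⟨fun z => if 0 ≤ z (Fin.last _) then F (‖z‖⁻¹ • (Fin.init z : Fin (k+1) → ℝ))
    else ν (F (-(‖z‖⁻¹ • (Fin.init z : Fin (k+1) → ℝ)))), ?_, ?_⟩
  · rw [continuousOn_iff_continuous_domRestrict]
    have hci : Continuous (fun z : ({0}ᶜ : Set (Fin (k+1+1) → ℝ)) =>
        ‖(z : Fin (k+1+1) → ℝ)‖⁻¹ • (Fin.init (z : Fin (k+1+1) → ℝ) : Fin (k+1) → ℝ)) := by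
      refine Continuous.smul (Continuous.inv₀ continuous_subtype_val.norm ?_) ?_
      · intro z
        exact norm_ne_zero_iff.2 z.2
      · refine continuous_pi fun i => ?_
        exact (continuous_apply i.castSucc).comp continuous_subtype_val
    refine Continuous.if_le (hF.comp hci) (hν.comp (hF.comp hci.neg)) continuous_const
      ((continuous_apply (Fin.last (k+1))).comp continuous_subtype_val) ?_
    intro z hz
    exact hFodd _ (hn z z.2 hz.symm)
  · intro z hz
    have hneg : (Fin.init (-z) : Fin (k+1) → ℝ) = -(Fin.init z : Fin (k+1) → ℝ) := rfl
    simp only [norm_neg, hneg, Pi.neg_apply, smul_neg, neg_neg]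
    rcases lt_trichotomy (z (Fin.last _)) 0 with h | h | h
    · rw [if_pos (by linarith), if_neg (by linarith), hinv]
    · rw [if_pos (by linarith), if_pos (by linarith), hFodd _ (hn z hz h), hinv]
    · rw [if_neg (by linarith), if_pos (by linarith)]

lemma hasOdd_zero {X : Type} [TopologicalSpace X] (ν : X → X)
    (hinv : ∀ x, ν (ν x) = x) (p : X) : HasOdd 0 X ν := by
  have hz0 : ∀ z : Fin (0+1) → ℝ, z ≠ 0 → z 0 ≠ 0 := by
    intro z hz h0
    apply hz
    ext i
    have hi : i = 0 := Fin.ext (by omega)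
    rw [hi, h0]; rfl
  refine ⟨fun z => if 0 ≤ z 0 then p else ν p, ?_, ?_⟩
  · rw [continuousOn_iff_continuous_domRestrict]
    refine Continuous.if_le continuous_const continuous_const continuous_const
      ((continuous_apply 0).comp continuous_subtype_val) ?_
    intro z hz
    exact absurd hz.symm (hz0 z z.2)
  · intro z hz
    have := hz0 z hz
    simp only [Pi.neg_apply]
    rcases lt_or_gt_of_ne this with h | h
    · rw [if_pos (by linarith), if_neg (by linarith), hinv]
    · rw [if_neg (by linarith), if_pos (by linarith)]

lemma hasOdd_all {d : ℕ} {X : Type} [TopologicalSpace X]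
    (e : X ≃ₜ sphere (0 : EuclideanSpace ℝ (Fin d)) 1) (ν : X → X) (hν : Continuous ν)
    (hinv : ∀ x, ν (ν x) = x) (p : X) : ∀ k, k < d → HasOdd k X ν := by
  intro k
  induction k with
  | zero => intro _; exact hasOdd_zero ν hinv p
  | succ k ih =>
    intro hk
    obtain ⟨G, hG, hodd⟩ := ih (by omega)
    obtain ⟨F, hF, hFG⟩ := ext_sphere e G hG (Or.inl hk)
    exact hasOdd_step ν hν hinv G hodd F hF hFG

end Topo
end PosetBU
namespace PosetBU
section Fin
open Set Metric CategoryTheory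

lemma no_cube {n : ℕ} (j : (Fin (n+1) → ℝ) → sphere (0 : EuclideanSpace ℝ (Fin (n+1))) 1)
    (hc : ContinuousOn j (closedBall 0 1)) (hi : InjOn j (closedBall 0 1)) : False := by
  have hfact : Fact (Module.finrank ℝ (EuclideanSpace ℝ (Fin (n+1))) = n + 1) :=
    ⟨finrank_euclideanSpace_fin⟩
  let st := stereographic' n (j 0)
  have hsrc : st.source = {j 0}ᶜ := stereographic'_source (j 0)
  have hball : ∀ z : Fin (n+1) → ℝ, z ≠ 0 → ‖z‖⁻¹ • z ∈ closedBall (0 : Fin (n+1) → ℝ) 1 :=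
    fun z hz => sphere_subset_closedBall (norm_inv_smul_mem hz)
  have hmem : ∀ z : Fin (n+1) → ℝ, z ≠ 0 → j (‖z‖⁻¹ • z) ∈ st.source := by
    intro z hz
    rw [hsrc]
    intro h
    have h1 := hi (hball z hz) (by simp) h
    have h2 := norm_inv_smul_mem hz
    rw [h1] at h2
    simp at h2
  let a : (Fin (n+1) → ℝ) → EuclideanSpace ℝ (Fin n) := fun z => st (j (‖z‖⁻¹ • z))
  have hca : ContinuousOn a {0}ᶜ := by
    refine st.continuousOn.comp (hc.comp ?_ (fun z hz => hball z hz)) (fun z hz => hmem z hz)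
    refine ContinuousOn.smul (ContinuousOn.inv₀ continuous_norm.continuousOn ?_) continuousOn_id
    intro x hx
    exact norm_ne_zero_iff.2 hx
  obtain ⟨z, hz, h0⟩ := borsuk_ulam n (fun z i => a z i - a (-z) i) (by
    have hca' : ContinuousOn (fun z => a (-z)) {0}ᶜ :=
      hca.comp continuousOn_neg (fun z hz => by simpa using hz)
    refine continuousOn_pi.2 fun i => ?_
    have hp : Continuous (fun v : EuclideanSpace ℝ (Fin n) => v i) := by fun_prop
    exact (hp.comp_continuousOn hca).sub (hp.comp_continuousOn hca')) (by
    intro z _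
    ext i
    simp)
  have h1 : a z = a (-z) := by
    ext i
    have := congrFun h0 i
    simpa [sub_eq_zero] using this
  have hz' : -z ≠ 0 := neg_ne_zero.2 hz
  have h2 := st.injOn (hmem z hz) (hmem _ hz') h1
  have h3 := hi (hball z hz) (hball _ hz') h2
  rw [norm_neg, smul_neg, self_eq_neg] at h3
  have h4 := norm_inv_smul_mem hz
  rw [h3] at h4
  simp at h4

/-- the cube embedded in a simplex of the same dimension. -/
noncomputable def cubeFun (n : ℕ) (x : Fin (n+1) → ℝ) : Fin (n+1+1) → ℝ :=
  Fin.cons (1 - ∑ i, (1 + x i) / (2 * (n+1))) (fun i => (1 + x i) / (2 * (n+1)))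

lemma cubeFun_mem (n : ℕ) (x : Fin (n+1) → ℝ) (hx : x ∈ closedBall (0 : Fin (n+1) → ℝ) 1) :
    cubeFun n x ∈ stdSimplex ℝ (Fin (n+1+1)) := by
  rw [mem_closedBall_zero_iff] at hx
  have hxi : ∀ i, |x i| ≤ 1 := fun i => (norm_le_pi_norm x i).trans hx
  constructor
  · intro i
    refine Fin.cases ?_ (fun i => ?_) i
    · simp only [cubeFun, Fin.cons_zero, sub_nonneg]
      have : ∀ i ∈ (Finset.univ : Finset (Fin (n+1))), (1 + x i) / (2 * ((n:ℝ)+1)) ≤ 1 / ((n:ℝ)+1) := by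
        intro i _
        rw [div_le_div_iff₀ (by positivity) (by positivity)]
        have := (abs_le.1 (hxi i)).2
        have hn : (0:ℝ) < (n:ℝ) + 1 := by positivity
        nlinarith
      refine (Finset.sum_le_sum this).trans ?_
      rw [Finset.sum_const, Finset.card_univ, Fintype.card_fin, nsmul_eq_mul]
      push_cast
      rw [mul_one_div_cancel (by positivity)]
    · simp only [cubeFun, Fin.cons_succ]
      have := (abs_le.1 (hxi i)).1
      have : 0 ≤ 1 + x i := by linarith
      positivity
  · rw [Fin.sum_univ_succ]
    simp [cubeFun]

lemma cubeFun_continuous (n : ℕ) : Continuous (cubeFun n) := by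
  refine continuous_pi fun i => ?_
  refine Fin.cases ?_ (fun i => ?_) i
  · simp only [cubeFun, Fin.cons_zero]
    fun_prop
  · simp only [cubeFun, Fin.cons_succ]
    fun_prop

lemma cubeFun_injective (n : ℕ) : Function.Injective (cubeFun n) := by
  intro x y h
  ext i
  have := congrFun h i.succ
  simp only [cubeFun, Fin.cons_succ] at this
  have hn : (2 * ((n:ℝ)+1)) ≠ 0 := by positivity
  rw [div_left_inj' hn] at this
  linarith

lemma dim_bound {d : ℕ} {Q : Type} [PartialOrder Q] [Fintype Q]
    (e : (SSet.toTop.obj (nerve Q)) ≃ₜ sphere (0 : EuclideanSpace ℝ (Fin (d+1))) 1)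
    (p : LTSeries Q) : p.length < d + 1 := by
  by_contra hlen
  push Not at hlen
  let c : Fin (d+1+1) → Q := fun i => p.toFun (Fin.castLE (by omega) i)
  have hcs : StrictMono c := p.strictMono.comp (Fin.strictMono_castLE _)
  have hpt : cubeFun d 0 ∈ stdSimplex ℝ (Fin (d+1+1)) := cubeFun_mem d 0 (by simp)
  classical
  let s : (Fin (d+1) → ℝ) → stdSimplex ℝ (Fin (d+1+1)) := fun x =>
    if hx : x ∈ closedBall (0 : Fin (d+1) → ℝ) 1 then ⟨cubeFun d x, cubeFun_mem d x hx⟩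
      else ⟨_, hpt⟩
  have hs : ∀ x ∈ closedBall (0 : Fin (d+1) → ℝ) 1, (s x).val = cubeFun d x := by
    intro x hx
    simp only [s, dif_pos hx]
  have hsc : ContinuousOn s (closedBall 0 1) := by
    rw [Topology.IsInducing.subtypeVal.continuousOn_iff]
    exact (cubeFun_continuous d).continuousOn.congr hs
  refine no_cube (fun x => e (cell c hcs.monotone (s x))) ?_ ?_
  · exact e.continuous.comp_continuousOn ((cell c hcs.monotone).continuous.comp_continuousOn hsc)
  · intro x hx y hy h
    have h1 := cell_injective c hcs.monotone hcs.injective (e.injective h)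
    have h2 := congrArg Subtype.val h1
    rw [hs x hx, hs y hy] at h2
    exact cubeFun_injective d h2

end Fin
end PosetBU

theorem statement11 {d : ℕ} (P Q : Type) [PartialOrder P] [PartialOrder Q]
    [Fintype P] [Fintype Q]
    (negP : P → P) (negQ : Q → Q)
    (hmonoP : ∀ x y : P, x ≤ y → negP x ≤ negP y)
    (hinvP : ∀ x, negP (negP x) = x) (hfreeP : ∀ x, negP x ≠ x)
    (hmonoQ : ∀ x y : Q, x ≤ y → negQ x ≤ negQ y)
    (hinvQ : ∀ x, negQ (negQ x) = x) (hfreeQ : ∀ x, negQ x ≠ x)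
    (hP : Nonempty ((SSet.toTop.obj (CategoryTheory.nerve P)) ≃ₜ
      (Metric.sphere (0 : EuclideanSpace ℝ (Fin d)) 1)))
    (hQ : Nonempty ((SSet.toTop.obj (CategoryTheory.nerve Q)) ≃ₜ
      (Metric.sphere (0 : EuclideanSpace ℝ (Fin d)) 1)))
    (φ : P → Q) (hφ : Monotone φ) (hequiv : ∀ x, φ (negP x) = negQ (φ x)) :
    Function.Surjective φ := by
  by_contra hns
  simp only [Function.Surjective, not_forall, not_exists] at hns
  obtain ⟨q, hq⟩ := hns
  obtain ⟨eP⟩ := hP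
  obtain ⟨eQ⟩ := hQ
  obtain ⟨y, hy⟩ := PosetBU.exists_missed φ hφ q hq
  have hmP : Monotone negP := fun x y h => hmonoP x y h
  have hmQ : Monotone negQ := fun x y h => hmonoQ x y h
  rcases d with _ | d
  · have h1 := mem_sphere_zero_iff_norm.1 (eQ y).2
    rw [Subsingleton.elim (eQ y : EuclideanSpace ℝ (Fin 0)) 0] at h1
    simp at h1
  have hinvP' : ∀ x, PosetBU.rmap negP hmP (PosetBU.rmap negP hmP x) = x := by
    intro x
    rw [PosetBU.rmap_comp]
    exact PosetBU.rmap_id _ _ hinvP x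
  have hinvQ' : ∀ x, PosetBU.rmap negQ hmQ (PosetBU.rmap negQ hmQ x) = x := by
    intro x
    rw [PosetBU.rmap_comp]
    exact PosetBU.rmap_id _ _ hinvQ x
  have hcomm : ∀ x, PosetBU.rmap φ hφ (PosetBU.rmap negP hmP x) =
      PosetBU.rmap negQ hmQ (PosetBU.rmap φ hφ x) := by
    intro x
    rw [PosetBU.rmap_comp, PosetBU.rmap_comp]
    have : φ ∘ negP = negQ ∘ φ := funext hequiv
    simp only [this]
  let p0 := eP.symm (eQ y)
  obtain ⟨G, hG, hodd⟩ := PosetBU.hasOdd_all eP (fun x => PosetBU.rmap negP hmP x)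
    (PosetBU.rmap negP hmP).hom.continuous hinvP' p0 d (Nat.lt_succ_self d)
  have hG' : ContinuousOn (fun z => PosetBU.rmap φ hφ (G z)) {0}ᶜ :=
    (PosetBU.rmap φ hφ).hom.continuous.comp_continuousOn hG
  have hodd' : ∀ z, z ≠ 0 → PosetBU.rmap φ hφ (G (-z)) =
      PosetBU.rmap negQ hmQ (PosetBU.rmap φ hφ (G z)) := by
    intro z hz
    rw [hodd z hz, hcomm]
  obtain ⟨F, hF, hFG⟩ := PosetBU.ext_sphere eQ (fun z => PosetBU.rmap φ hφ (G z)) hG'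
    (Or.inr ⟨y, fun z _ => hy (G z)⟩)
  obtain ⟨H, hH, hHodd⟩ := PosetBU.hasOdd_step (fun x => PosetBU.rmap negQ hmQ x)
    (PosetBU.rmap negQ hmQ).hom.continuous hinvQ' _ hodd' F hF hFG
  obtain ⟨g, hg, hgodd, hgne⟩ := PosetBU.exists_odd_map (d+1) negQ hmQ hinvQ hfreeQ
    (fun p => PosetBU.dim_bound eQ p)
  obtain ⟨z, hz, h0⟩ := PosetBU.borsuk_ulam (d+1) (fun z => g (H z))
    (hg.comp_continuousOn hH) (by
      intro z hz
      show g (H (-z)) = - g (H z)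
      rw [hHodd z hz, hgodd])
  exact hgne _ h0
end

section
/- Let S, T ∈ {-1,0,+1}^d be sign vectors and let σ ⊆ C_S and τ ⊆ C_T be nonempty sets. If the Minkowski sums □_S + S·σ and □_T + T·τ intersect, then S and T are conformal, and (□_S + S·σ) ∩ (□_T + T·τ) = □_{S∘T} + (S∘T)·(σ ∩ τ). -/
open Pointwise

/-- The cube `□_d = [-1,1]^d ⊆ ℝ^d`. -/
def cube (d : ℕ) : Set (Fin d → ℝ) := {x | ∀ i, |x i| ≤ 1}

/-- The face `□_S` of the cube determined by the sign vector `S`. -/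
def cubeFace {d : ℕ} (S : Fin d → SignType) : Set (Fin d → ℝ) :=
  {x | (∀ i, |x i| ≤ 1) ∧ ∀ i, S i ≠ 0 → x i = (S i : ℝ)}

/-- The cone `C_S = {x : x i ≥ 0 for all i, x i = 0 for i ∉ supp S}`. -/
def cone {d : ℕ} (S : Fin d → SignType) : Set (Fin d → ℝ) :=
  {x | (∀ i, 0 ≤ x i) ∧ ∀ i, S i = 0 → x i = 0}

/-- The reflection `S·K` of a set `K ⊆ ℝ^d` into the orthant indicated by `S`. -/
def sdot {d : ℕ} (S : Fin d → SignType) (K : Set (Fin d → ℝ)) : Set (Fin d → ℝ) :=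
  (fun x => fun i => (S i : ℝ) * x i) '' K

/-! Statement 13: if `□_S + S·σ` and `□_T + T·τ` intersect (for nonempty `σ ⊆ C_S`,
`τ ⊆ C_T`), then `S` and `T` are conformal and the intersection equals
`□_{S∘T} + (S∘T)·(σ ∩ τ)`. -/

/-- `S` and `T` are conformal sign vectors: no `i` with `S i = -T i ≠ 0`. -/
def SignConformal {d : ℕ} (S T : Fin d → SignType) : Prop := ∀ i, S i ≠ 0 → S i ≠ -T i

/-- The composition `S∘T` of sign vectors. -/
def scomp {d : ℕ} (S T : Fin d → SignType) : Fin d → SignType :=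
  fun i => if S i ≠ 0 then S i else T i

theorem mem_sum_iff {d : ℕ} (S : Fin d → SignType) (K : Set (Fin d → ℝ)) (x : Fin d → ℝ) :
    x ∈ cubeFace S + sdot S K ↔
      ∃ u ∈ K, ∀ i, (S i = 0 → |x i| ≤ 1) ∧ (S i = 1 → x i = 1 + u i) ∧
        (S i = -1 → x i = -1 - u i) := by
  constructor
  · rintro ⟨a, ⟨ha, ha'⟩, b, ⟨u, hu, rfl⟩, rfl⟩
    refine ⟨u, hu, fun i => ?_⟩
    have h1 := ha i
    have h2 := ha' i
    refine ⟨fun h => ?_, fun h => ?_, fun h => ?_⟩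
    · simpa [h] using h1
    · simp [h] at h2 ⊢
      linarith
    · simp [h] at h2 ⊢
      linarith
  · rintro ⟨u, hu, h⟩
    refine ⟨fun i => x i - (S i : ℝ) * u i, ⟨fun i => ?_, fun i hi => ?_⟩, _, ⟨u, hu, rfl⟩, ?_⟩
    · obtain ⟨h0, h1, h2⟩ := h i
      rcases SignType.trichotomy (S i) with hs | hs | hs
      · simp [hs, h2 hs]
      · simpa [hs] using h0 hs
      · simp [hs, h1 hs]
    · obtain ⟨h0, h1, h2⟩ := h i
      rcases SignType.trichotomy (S i) with hs | hs | hs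
      · simp [hs, h2 hs]
      · exact absurd hs hi
      · simp [hs, h1 hs]
    · funext i
      simp

theorem coord_key {s t : SignType} {u v x : ℝ} (hu : 0 ≤ u) (hv : 0 ≤ v)
    (hu0 : s = 0 → u = 0) (hv0 : t = 0 → v = 0)
    (hs : (s = 0 → |x| ≤ 1) ∧ (s = 1 → x = 1 + u) ∧ (s = -1 → x = -1 - u))
    (ht : (t = 0 → |x| ≤ 1) ∧ (t = 1 → x = 1 + v) ∧ (t = -1 → x = -1 - v)) :
    (s ≠ 0 → s ≠ -t) ∧ u = v := by
  rcases SignType.trichotomy s with rfl | rfl | rfl <;>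
  rcases SignType.trichotomy t with rfl | rfl | rfl <;>
  simp [abs_le] at hu0 hv0 hs ht ⊢ <;> (try constructor) <;> (try decide) <;> linarith

theorem statement13 {d : ℕ} (hd : 1 ≤ d) (S T : Fin d → SignType)
    (σ τ : Set (Fin d → ℝ)) (hσsub : σ ⊆ cone S) (hτsub : τ ⊆ cone T)
    (hσ : σ.Nonempty) (hτ : τ.Nonempty)
    (hint : ((cubeFace S + sdot S σ) ∩ (cubeFace T + sdot T τ)).Nonempty) :
    SignConformal S T ∧
      (cubeFace S + sdot S σ) ∩ (cubeFace T + sdot T τ) =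
        cubeFace (scomp S T) + sdot (scomp S T) (σ ∩ τ) := by
  simp only [mem_sum_iff, Set.Nonempty, Set.mem_inter_iff] at hint
  obtain ⟨x, ⟨u, hu, hxu⟩, ⟨v, hv, hxv⟩⟩ := hint
  have hconf : SignConformal S T := fun i =>
    (coord_key ((hσsub hu).1 i) ((hτsub hv).1 i) ((hσsub hu).2 i) ((hτsub hv).2 i)
      (hxu i) (hxv i)).1
  refine ⟨hconf, ?_⟩
  clear hxu hxv hu hv
  ext y
  simp only [mem_sum_iff, Set.mem_inter_iff]
  constructor
  · rintro ⟨⟨u, hu, hyu⟩, ⟨v, hv, hyv⟩⟩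
    have huv : u = v := funext fun i =>
      (coord_key ((hσsub hu).1 i) ((hτsub hv).1 i) ((hσsub hu).2 i) ((hτsub hv).2 i)
        (hyu i) (hyv i)).2
    subst huv
    refine ⟨u, ⟨hu, hv⟩, fun i => ?_⟩
    unfold scomp
    split_ifs
    · exact hyu i
    · exact hyv i
  · rintro ⟨u, ⟨hu, hv⟩, hy⟩
    refine ⟨⟨u, hu, fun i => ?_⟩, ⟨u, hv, fun i => ?_⟩⟩ <;>
    · have h := hy i
      have hc := hconf i
      have h1 := (hσsub hu).2 i
      have h2 := (hτsub hv).2 i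
      unfold scomp at h
      generalize S i = s at *
      generalize T i = t at *
      rcases SignType.trichotomy s with rfl | rfl | rfl <;>
      rcases SignType.trichotomy t with rfl | rfl | rfl <;>
      simp_all
end

section
/- Let S, T ∈ {-1,0,+1}^d be nonzero sign vectors and let σ ⊆ C_S and τ ⊆ C_T be nonempty sets. If □_S + S·σ = □_T + T·τ, then S = T and σ = τ; that is, both S and σ can be recovered from the Minkowski sum □_S + S·σ. -/
open Pointwise

/-! Statement 15: for nonzero sign vectors `S`, `T` and nonempty `σ ⊆ C_S`, `τ ⊆ C_T`,
if `□_S + S·σ = □_T + T·τ` then `S = T` and `σ = τ`; i.e. both `S` and `σ` can be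
recovered from the Minkowski sum `□_S + S·σ`. -/

/-- Each point of `σ` gives a canonical point of the sum; it lies in the other sum. -/
lemma key15 {d : ℕ} (S T : Fin d → SignType) (σ τ : Set (Fin d → ℝ))
    (h : cubeFace S + sdot S σ ⊆ cubeFace T + sdot T τ) (y : Fin d → ℝ) (hy : y ∈ σ) :
    ∃ z ∈ τ, ∀ i, T i ≠ 0 → (S i : ℝ) * (1 + y i) = (T i : ℝ) * (1 + z i) := by
  have hx : ((fun i => (S i : ℝ)) + (fun i => (S i : ℝ) * y i)) ∈ cubeFace S + sdot S σ := by
    refine Set.add_mem_add ⟨fun i => ?_, fun i _ => rfl⟩ ⟨y, hy, rfl⟩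
    change |(S i : ℝ)| ≤ 1
    rcases (S i).trichotomy with e | e | e <;> rw [e] <;> simp
  obtain ⟨a, ha, b, ⟨z, hz, rfl⟩, hab⟩ := Set.mem_add.1 (h hx)
  refine ⟨z, hz, fun i hi => ?_⟩
  have h1 := congrFun hab i
  have h2 := ha.2 i hi
  simp only [Pi.add_apply] at h1
  rw [h2] at h1
  linarith

lemma sign15 {d : ℕ} (S T : Fin d → SignType) (σ τ : Set (Fin d → ℝ))
    (hσsub : σ ⊆ cone S) (hτsub : τ ⊆ cone T) (hσ : σ.Nonempty)
    (h : cubeFace S + sdot S σ ⊆ cubeFace T + sdot T τ) (i : Fin d) (hi : T i ≠ 0) :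
    S i = T i := by
  obtain ⟨y, hy⟩ := hσ
  obtain ⟨z, hz, hyz⟩ := key15 S T σ τ h y hy
  have h1 := hyz i hi
  have h2 := (hσsub hy).1 i
  have h3 := (hτsub hz).1 i
  generalize S i = s at *
  generalize T i = t at *
  rcases s.trichotomy with rfl | rfl | rfl <;> rcases t.trichotomy with rfl | rfl | rfl <;>
    simp at h1 hi ⊢ <;> linarith

lemma sub15 {d : ℕ} (S : Fin d → SignType) (σ τ : Set (Fin d → ℝ))
    (hσsub : σ ⊆ cone S) (hτsub : τ ⊆ cone S)
    (h : cubeFace S + sdot S σ ⊆ cubeFace S + sdot S τ) : σ ⊆ τ := by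
  intro y hy
  obtain ⟨z, hz, hyz⟩ := key15 S S σ τ h y hy
  have : y = z := by
    funext i
    by_cases hi : S i = 0
    · rw [(hσsub hy).2 i hi, (hτsub hz).2 i hi]
    · have h1 := hyz i hi
      generalize S i = s at *
      rcases s.trichotomy with rfl | rfl | rfl
      · simp at h1; linarith
      · exact absurd rfl hi
      · simp at h1; linarith
  exact this ▸ hz

theorem statement15 {d : ℕ} (hd : 1 ≤ d) (S T : Fin d → SignType)
    (hS : S ≠ 0) (hT : T ≠ 0)
    (σ τ : Set (Fin d → ℝ)) (hσsub : σ ⊆ cone S) (hτsub : τ ⊆ cone T)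
    (hσ : σ.Nonempty) (hτ : τ.Nonempty)
    (heq : cubeFace S + sdot S σ = cubeFace T + sdot T τ) :
    S = T ∧ σ = τ := by
  have hST : S = T := by
    funext i
    by_cases hi : T i = 0
    · by_cases hi2 : S i = 0
      · rw [hi, hi2]
      · exact (sign15 T S τ σ hτsub hσsub hτ heq.symm.subset i hi2).symm
    · exact sign15 S T σ τ hσsub hτsub hσ heq.subset i hi
  subst hST
  exact ⟨rfl, (sub15 S σ τ hσsub hτsub heq.subset).antisymm
    (sub15 S τ σ hτsub hσsub heq.symm.subset)⟩
end

section
/- Let c ∈ ℝ^d be nonzero, let S ∈ {-1,0,+1}^d be its componentwise sign vector (S_i = sign(c_i)), and let I = {i : |c_i| = max_k |c_k|}. Then the set of maximizers of the linear functional x ↦ ⟨c,x⟩ over the Minkowski sum □_d + n◊_d is exactly □_S + S·(nΔ_I). -/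
open Pointwise

/-! Statement 16: for nonzero `c ∈ ℝ^d` with componentwise sign vector `S` and
`I = {i : |c i| = max_k |c k|}`, the set of maximizers of `x ↦ ⟨c,x⟩` over `□_d + n◊_d`
is exactly `□_S + S·(nΔ_I)`. -/

/-- The scaled crosspolytope `n◊_d = {x : ∑ |x i| ≤ n}`. -/
def diamond (d : ℕ) (n : ℝ) : Set (Fin d → ℝ) := {x | ∑ i, |x i| ≤ n}

/-- The face `nΔ_I` of the dilated simplex `nΔ_{d-1}` supported on `I`. -/
def simplexFace {d : ℕ} (n : ℝ) (I : Set (Fin d)) : Set (Fin d → ℝ) :=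
  {x | (∀ i, 0 ≤ x i) ∧ (∀ i ∉ I, x i = 0) ∧ ∑ i, x i = n}

theorem statement16 {d : ℕ} (hd : 1 ≤ d) (n : ℝ) (hn : 0 < n)
    (c : Fin d → ℝ) (hc : c ≠ 0)
    (S : Fin d → SignType) (hS : ∀ i, S i = SignType.sign (c i))
    (I : Set (Fin d)) (hI : I = {i | ∀ k, |c k| ≤ |c i|}) :
    {x ∈ cube d + diamond d n |
        ∀ y ∈ cube d + diamond d n, ∑ i, c i * y i ≤ ∑ i, c i * x i} =
      cubeFace S + sdot S (simplexFace n I) := by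
  haveI : Nonempty (Fin d) := ⟨⟨0, hd⟩⟩
  obtain ⟨k, hk⟩ := Finite.exists_max (fun i => |c i|)
  obtain ⟨j, hj⟩ := Function.ne_iff.mp hc
  have hm : 0 < |c k| := lt_of_lt_of_le (abs_pos.mpr hj) (hk j)
  have hkI : k ∈ I := by rw [hI]; exact hk
  have hIe : ∀ i ∈ I, |c i| = |c k| := by
    intro i hi
    rw [hI] at hi
    exact le_antisymm (hk i) (hi k)
  have hIn : ∀ i, i ∉ I → |c i| < |c k| := by
    intro i hi
    by_contra h
    apply hi
    rw [hI]
    intro l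
    exact (hk l).trans (not_lt.mp h)
  have hcS : ∀ i, c i * (S i : ℝ) = |c i| := by
    intro i
    rw [hS]
    exact self_mul_sign (c i)
  have hSabs : ∀ i, |(S i : ℝ)| ≤ 1 := by
    intro i
    cases S i <;> simp
  have hS0 : ∀ i, S i ≠ 0 ↔ c i ≠ 0 := by
    intro i
    rw [hS, Ne, sign_eq_zero_iff]
  have hSS : ∀ i, c i ≠ 0 → (S i : ℝ) * S i = 1 := by
    intro i hi
    have := (hS0 i).mpr hi
    revert this
    cases S i <;> simp
  -- members of the right-hand side lie in the sum
  have hmem : ∀ a ∈ cubeFace S, ∀ z ∈ simplexFace n I,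
      (a + fun i => (S i : ℝ) * z i) ∈ cube d + diamond d n := by
    intro a ha z hz
    refine Set.add_mem_add ha.1 ?_
    show ∑ i, |(S i : ℝ) * z i| ≤ n
    rw [← hz.2.2]
    refine Finset.sum_le_sum fun i _ => ?_
    rw [abs_mul, abs_of_nonneg (hz.1 i)]
    exact mul_le_of_le_one_left (hz.1 i) (hSabs i)
  have hval : ∀ a ∈ cubeFace S, ∀ z ∈ simplexFace n I,
      ∑ i, c i * (a + fun i => (S i : ℝ) * z i) i = ∑ i, |c i| + |c k| * n := by
    intro a ha z hz
    rw [← hz.2.2, Finset.mul_sum, ← Finset.sum_add_distrib]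
    refine Finset.sum_congr rfl fun i _ => ?_
    have h1 : c i * a i = |c i| := by
      by_cases h : c i = 0
      · simp [h]
      · rw [ha.2 i ((hS0 i).mpr h), hcS]
    have h2 : |c i| * z i = |c k| * z i := by
      by_cases h : i ∈ I
      · rw [hIe i h]
      · rw [hz.2.1 i h]; simp
    rw [Pi.add_apply, mul_add, h1, ← mul_assoc, hcS, h2]
  have hca : ∀ a ∈ cube d, ∀ i, c i * a i ≤ |c i| := by
    intro a ha i
    calc c i * a i ≤ |c i * a i| := le_abs_self _
      _ = |c i| * |a i| := abs_mul _ _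
      _ ≤ |c i| := mul_le_of_le_one_right (abs_nonneg _) (ha i)
  have hcb : ∀ (b : Fin d → ℝ) (i), c i * b i ≤ |c k| * |b i| := by
    intro b i
    calc c i * b i ≤ |c i * b i| := le_abs_self _
      _ = |c i| * |b i| := abs_mul _ _
      _ ≤ _ := mul_le_mul_of_nonneg_right (hk i) (abs_nonneg _)
  ext x
  constructor
  · rintro ⟨⟨a, ha, b, hb, rfl⟩, hmax⟩
    have hbn : ∑ i, |b i| ≤ n := hb
    have haF : (fun i => (S i : ℝ)) ∈ cubeFace S := ⟨hSabs, fun i _ => rfl⟩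
    have hzF : Pi.single k n ∈ simplexFace n I := by
      refine ⟨fun i => ?_, fun i hi => ?_, ?_⟩
      · by_cases h : i = k
        · subst h; simp [hn.le]
        · simp [h]
      · have h : i ≠ k := by rintro rfl; exact hi hkI
        simp [h]
      · simp
    have hge := hmax _ (hmem _ haF _ hzF)
    rw [hval _ haF _ hzF] at hge
    have hsplit : ∑ i, c i * (a + b) i = ∑ i, c i * a i + ∑ i, c i * b i := by
      rw [← Finset.sum_add_distrib]
      exact Finset.sum_congr rfl fun i _ => by rw [Pi.add_apply, mul_add]
    have hge' : ∑ i, |c i| + |c k| * n ≤ ∑ i, c i * a i + ∑ i, c i * b i := by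
      rw [← hsplit]; exact hge
    have hA : ∑ i, c i * a i ≤ ∑ i, |c i| := Finset.sum_le_sum fun i _ => hca a ha i
    have hB : ∑ i, c i * b i ≤ ∑ i, |c k| * |b i| := Finset.sum_le_sum fun i _ => hcb b i
    have hB2 : ∑ i, |c k| * |b i| ≤ |c k| * n := by
      rw [← Finset.mul_sum]
      exact mul_le_mul_of_nonneg_left hbn hm.le
    have eA := (Finset.sum_eq_sum_iff_of_le fun i _ => hca a ha i).mp
      (show ∑ i, c i * a i = ∑ i, |c i| by linarith)
    have eB := (Finset.sum_eq_sum_iff_of_le fun i _ => hcb b i).mp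
      (show ∑ i, c i * b i = ∑ i, |c k| * |b i| by linarith)
    have eN : ∑ i, |b i| = n := by
      have : |c k| * ∑ i, |b i| = |c k| * n := by
        rw [Finset.mul_sum]; linarith
      exact mul_left_cancel₀ hm.ne' this
    have hb0 : ∀ i, i ∉ I → b i = 0 := by
      intro i hi
      by_contra h
      have h1 := eB i (Finset.mem_univ i)
      have h2 : c i * b i ≤ |c i| * |b i| := by rw [← abs_mul]; exact le_abs_self _
      have h3 := mul_lt_mul_of_pos_right (hIn i hi) (abs_pos.mpr h)
      linarith
    refine Set.add_mem_add ⟨ha, fun i hi => ?_⟩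
      ⟨fun i => |b i|, ⟨fun i => abs_nonneg _, fun i hi => ?_, eN⟩, ?_⟩
    · have h := eA i (Finset.mem_univ i)
      rw [← hcS] at h
      exact mul_left_cancel₀ ((hS0 i).mp hi) h
    · simp [hb0 i hi]
    · funext i
      show (S i : ℝ) * |b i| = b i
      by_cases hi : i ∈ I
      · have h := eB i (Finset.mem_univ i)
        rw [← hIe i hi, ← hcS, mul_assoc] at h
        have hci : c i ≠ 0 := by
          rw [← abs_pos, hIe i hi]; exact hm
        exact (mul_left_cancel₀ hci h).symm
      · simp [hb0 i hi]
  · rintro ⟨a, ha, _, ⟨z, hz, rfl⟩, rfl⟩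
    refine ⟨hmem a ha z hz, ?_⟩
    rintro _ ⟨a', ha', b, hb, rfl⟩
    have hv := hval a ha z hz
    have hbn : ∑ i, |b i| ≤ n := hb
    refine le_trans ?_ hv.ge
    calc ∑ i, c i * (a' + b) i = ∑ i, c i * a' i + ∑ i, c i * b i := by
          rw [← Finset.sum_add_distrib]
          exact Finset.sum_congr rfl fun i _ => by rw [Pi.add_apply, mul_add]
      _ ≤ ∑ i, |c i| + ∑ i, |c k| * |b i| :=
          add_le_add (Finset.sum_le_sum fun i _ => hca a' ha' i)
            (Finset.sum_le_sum fun i _ => hcb b i)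
      _ ≤ _ := by
          rw [← Finset.mul_sum]
          exact add_le_add_right (mul_le_mul_of_nonneg_left hbn hm.le) _
end

section
/- A set B ⊆ ℝ^d is a nonempty proper exposed face of the polytope □_d + n◊_d if and only if there exist a nonzero sign vector S ∈ {-1,0,+1}^d and a nonempty subset I ⊆ supp(S) such that B = □_S + S·(nΔ_I). -/
open Pointwise

/-- `B` is an exposed face of `K`: the set of maximizers over `K` of some linear
functional. -/
def IsExposedFaceOf {d : ℕ} (K B : Set (Fin d → ℝ)) : Prop :=
  ∃ c : Fin d → ℝ, B = {x ∈ K | ∀ y ∈ K, ∑ i, c i * y i ≤ ∑ i, c i * x i}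

lemma sgn_mul_c (a : ℝ) : a * ((SignType.sign a : SignType) : ℝ) = |a| := self_mul_sign a

lemma cube_le {d : ℕ} (c x : Fin d → ℝ) (hx : x ∈ cube d) (i : Fin d) : c i * x i ≤ |c i| := by
  calc c i * x i ≤ |c i * x i| := le_abs_self _
    _ = |c i| * |x i| := abs_mul _ _
    _ ≤ |c i| * 1 := mul_le_mul_of_nonneg_left (hx i) (abs_nonneg _)
    _ = |c i| := mul_one _

lemma cube_face_iff {d : ℕ} (c x : Fin d → ℝ) :
    x ∈ cubeFace (fun i => SignType.sign (c i)) ↔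
      x ∈ cube d ∧ ∑ i, c i * x i = ∑ i, |c i| := by
  constructor
  · rintro ⟨h1, h2⟩
    refine ⟨h1, Finset.sum_congr rfl fun i _ => ?_⟩
    by_cases hc : c i = 0
    · simp [hc]
    · rw [h2 i (by simpa [sign_eq_zero_iff] using hc)]
      exact sgn_mul_c _
  · rintro ⟨h1, h2⟩
    refine ⟨h1, fun i hi => ?_⟩
    have hc : c i ≠ 0 := by
      intro h; exact hi (by simp [h])
    have h3 := (Finset.sum_eq_sum_iff_of_le (fun i _ => cube_le c x h1 i)).1 h2 i (Finset.mem_univ i)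
    rw [← sgn_mul_c] at h3
    exact mul_left_cancel₀ hc h3

lemma dia_le {d : ℕ} (c y : Fin d → ℝ) (M : ℝ) (hM : ∀ i, |c i| ≤ M) (i : Fin d) :
    c i * y i ≤ M * |y i| := by
  calc c i * y i ≤ |c i * y i| := le_abs_self _
    _ = |c i| * |y i| := abs_mul _ _
    _ ≤ M * |y i| := mul_le_mul_of_nonneg_right (hM i) (abs_nonneg _)

lemma dia_sum_le {d : ℕ} (n : ℝ) (c y : Fin d → ℝ) (M : ℝ) (hM0 : 0 < M) (hM : ∀ i, |c i| ≤ M)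
    (hy : y ∈ diamond d n) : ∑ i, c i * y i ≤ M * n := by
  calc ∑ i, c i * y i ≤ ∑ i, M * |y i| := Finset.sum_le_sum fun i _ => dia_le c y M hM i
    _ = M * ∑ i, |y i| := by rw [Finset.mul_sum]
    _ ≤ M * n := mul_le_mul_of_nonneg_left hy hM0.le

lemma dia_face_iff {d : ℕ} (n : ℝ) (c y : Fin d → ℝ) (M : ℝ) (hM0 : 0 < M)
    (hM : ∀ i, |c i| ≤ M) :
    y ∈ sdot (fun i => SignType.sign (c i)) (simplexFace n {i | |c i| = M}) ↔
      y ∈ diamond d n ∧ ∑ i, c i * y i = M * n := by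
  constructor
  · rintro ⟨x, ⟨h0, h1, h2⟩, rfl⟩
    constructor
    · change ∑ i, |((SignType.sign (c i) : SignType) : ℝ) * x i| ≤ n
      rw [← h2]
      refine Finset.sum_le_sum fun i _ => ?_
      rw [abs_mul, abs_of_nonneg (h0 i)]
      have : |((SignType.sign (c i) : SignType) : ℝ)| ≤ 1 := by
        cases SignType.sign (c i) <;> simp
      nlinarith [h0 i]
    · rw [← h2, Finset.mul_sum]
      refine Finset.sum_congr rfl fun i _ => ?_
      change c i * (((SignType.sign (c i) : SignType) : ℝ) * x i) = _
      rw [← mul_assoc, sgn_mul_c]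
      by_cases hi : |c i| = M
      · rw [hi]
      · rw [h1 i hi]; simp
  · rintro ⟨h1, h2⟩
    have hs : ∑ i, |y i| = n := by
      refine le_antisymm h1 ?_
      have : M * n ≤ M * ∑ i, |y i| := by
        rw [← h2, Finset.mul_sum]
        exact Finset.sum_le_sum fun i _ => dia_le c y M hM i
      exact le_of_mul_le_mul_left this hM0
    have h3 : ∀ i, c i * y i = M * |y i| := by
      intro i
      refine (Finset.sum_eq_sum_iff_of_le (fun i _ => dia_le c y M hM i)).1 ?_ i (Finset.mem_univ i)
      rw [h2, ← Finset.mul_sum, hs]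
    have h4 : ∀ i, y i ≠ 0 → |c i| = M := by
      intro i hi
      have := congrArg abs (h3 i)
      rw [abs_mul, abs_mul, abs_abs, abs_of_pos hM0] at this
      exact mul_right_cancel₀ (abs_ne_zero.2 hi) this
    refine ⟨fun i => |y i|, ⟨fun i => abs_nonneg _, fun i hi => ?_, hs⟩, ?_⟩
    · by_contra h
      exact hi (h4 i (by simpa using h))
    · funext i
      change ((SignType.sign (c i) : SignType) : ℝ) * |y i| = y i
      by_cases hi : y i = 0
      · simp [hi]
      · have hc : c i ≠ 0 := by
          intro h
          have := h4 i hi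
          rw [h] at this
          simp at this
          linarith
        apply mul_left_cancel₀ hc
        rw [← mul_assoc, sgn_mul_c, h4 i hi, h3 i]

lemma face_main {d : ℕ} (n : ℝ) (hn : 0 < n) (c : Fin d → ℝ) (M : ℝ) (hM0 : 0 < M)
    (hM : ∀ i, |c i| ≤ M) (j : Fin d) (hj : |c j| = M) :
    ({x ∈ cube d + diamond d n | ∀ y ∈ cube d + diamond d n, ∑ i, c i * y i ≤ ∑ i, c i * x i}
      = cubeFace (fun i => SignType.sign (c i)) +
        sdot (fun i => SignType.sign (c i)) (simplexFace n {i | |c i| = M})) ∧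
    (cubeFace (fun i => SignType.sign (c i)) +
        sdot (fun i => SignType.sign (c i)) (simplexFace n {i | |c i| = M})).Nonempty ∧
    (cubeFace (fun i => SignType.sign (c i)) +
        sdot (fun i => SignType.sign (c i)) (simplexFace n {i | |c i| = M})) ≠
      cube d + diamond d n := by
  have sadd : ∀ a b : Fin d → ℝ, ∑ i, c i * (a + b) i = ∑ i, c i * a i + ∑ i, c i * b i := by
    intro a b
    simp [mul_add, Finset.sum_add_distrib]
  have cle : ∀ a ∈ cube d, ∑ i, c i * a i ≤ ∑ i, |c i| := fun a ha =>
    Finset.sum_le_sum fun i _ => cube_le c a ha i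
  have ne1 : (fun i => ((SignType.sign (c i) : SignType) : ℝ)) ∈
      cubeFace (fun i => SignType.sign (c i)) := by
    refine ⟨fun i => ?_, fun i _ => rfl⟩
    change |((SignType.sign (c i) : SignType) : ℝ)| ≤ 1
    cases SignType.sign (c i) <;> simp
  have ne2 : (fun i => ((SignType.sign (c i) : SignType) : ℝ) * (Pi.single j n : Fin d → ℝ) i) ∈
      sdot (fun i => SignType.sign (c i)) (simplexFace n {i | |c i| = M}) := by
    refine ⟨Pi.single j n, ⟨fun i => ?_, fun i hi => ?_, ?_⟩, rfl⟩
    · by_cases h : i = j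
      · subst h; simpa using hn.le
      · simp [h]
    · have : i ≠ j := by rintro rfl; exact hi hj
      simp [this]
    · simp
  have n1 := (cube_face_iff c _).1 ne1
  have n2 := (dia_face_iff n c _ M hM0 hM).1 ne2
  refine ⟨?_, ⟨_, Set.add_mem_add ne1 ne2⟩, ?_⟩
  · ext x
    constructor
    · rintro ⟨⟨a, ha, b, hb, rfl⟩, hmax⟩
      have h := hmax _ (Set.add_mem_add n1.1 n2.1)
      rw [sadd, n1.2, n2.2] at h
      change _ ≤ ∑ i, c i * (a + b) i at h
      rw [sadd] at h
      have h1 := cle a ha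
      have h2 := dia_sum_le n c b M hM0 hM hb
      exact Set.add_mem_add ((cube_face_iff c a).2 ⟨ha, by linarith⟩)
        ((dia_face_iff n c b M hM0 hM).2 ⟨hb, by linarith⟩)
    · rintro ⟨a, ha, b, hb, rfl⟩
      have ha' := (cube_face_iff c a).1 ha
      have hb' := (dia_face_iff n c b M hM0 hM).1 hb
      refine ⟨Set.add_mem_add ha'.1 hb'.1, ?_⟩
      rintro _ ⟨u, hu, v, hv, rfl⟩
      change ∑ i, c i * (u + v) i ≤ ∑ i, c i * (a + b) i
      rw [sadd, sadd, ha'.2, hb'.2]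
      exact add_le_add (cle u hu) (dia_sum_le n c v M hM0 hM hv)
  · intro heq
    have h0 : (0 : Fin d → ℝ) ∈ cube d + diamond d n := by
      refine ⟨0, fun i => by simp, 0, ?_, by simp⟩
      change ∑ i, |(0 : Fin d → ℝ) i| ≤ n
      simpa using hn.le
    rw [← heq] at h0
    obtain ⟨a, ha, b, hb, hab⟩ := h0
    have ha' := (cube_face_iff c a).1 ha
    have hb' := (dia_face_iff n c b M hM0 hM).1 hb
    have h := sadd a b
    change a + b = 0 at hab
    rw [hab, ha'.2, hb'.2] at h
    simp only [Pi.zero_apply, mul_zero, Finset.sum_const_zero] at h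
    have : 0 ≤ ∑ i, |c i| := Finset.sum_nonneg fun i _ => abs_nonneg _
    nlinarith [mul_pos hM0 hn]

theorem statement17 {d : ℕ} (hd : 1 ≤ d) (n : ℝ) (hn : 0 < n) (B : Set (Fin d → ℝ)) :
    (B.Nonempty ∧ B ≠ cube d + diamond d n ∧ IsExposedFaceOf (cube d + diamond d n) B) ↔
      (∃ S : Fin d → SignType, S ≠ 0 ∧ ∃ I : Set (Fin d), I.Nonempty ∧
        (∀ i ∈ I, S i ≠ 0) ∧ B = cubeFace S + sdot S (simplexFace n I)) := by
  constructor
  · rintro ⟨-, hB, c, hc⟩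
    have hc0 : c ≠ 0 := by
      rintro rfl
      apply hB
      rw [hc]
      simp
    obtain ⟨k, hk⟩ := Function.ne_iff.1 hc0
    obtain ⟨j, -, hj⟩ := Finset.exists_max_image Finset.univ (fun i => |c i|) ⟨k, Finset.mem_univ k⟩
    have hM0 : 0 < |c j| := lt_of_lt_of_le (abs_pos.2 hk) (hj k (Finset.mem_univ k))
    have key := face_main n hn c |c j| hM0 (fun i => hj i (Finset.mem_univ i)) j rfl
    refine ⟨fun i => SignType.sign (c i), ?_, {i | |c i| = |c j|}, ⟨j, rfl⟩, ?_, hc.trans key.1⟩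
    · intro h
      exact hk (sign_eq_zero_iff.1 (congrFun h k))
    · intro i hi h
      have h' : |c i| = |c j| := hi
      rw [sign_eq_zero_iff.1 h, abs_zero] at h'
      linarith
  · rintro ⟨S, -, I, ⟨j, hj⟩, hI, rfl⟩
    classical
    let c : Fin d → ℝ := fun i => (S i : ℝ) * (if i ∈ I then 2 else 1)
    have hS : (fun i => SignType.sign (c i)) = S := by
      funext i
      have : (0 : ℝ) < (if i ∈ I then 2 else 1) := by split_ifs <;> norm_num
      simp only [c, sign_mul, sign_pos this, mul_one]
      cases S i <;> simp
    have hle : ∀ i, |(S i : ℝ)| ≤ 1 := by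
      intro i; cases S i <;> simp
    have h1 : ∀ i ∈ I, |c i| = 2 := by
      intro i hi
      have := hI i hi
      simp only [c, hi, if_true]
      revert this
      cases S i <;> simp
    have h2 : ∀ i, i ∉ I → |c i| ≤ 1 := by
      intro i hi
      simpa [c, hi] using hle i
    have hII : {i | |c i| = 2} = I := by
      ext i
      constructor
      · intro h
        by_contra hi
        have := h2 i hi
        have h' : |c i| = 2 := h
        linarith
      · exact h1 i
    have key := face_main n hn c 2 two_pos (fun i => by
      by_cases hi : i ∈ I
      · exact (h1 i hi).le
      · linarith [h2 i hi]) j (h1 j hj)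
    rw [hS, hII] at key
    exact ⟨key.2.1, key.2.2, c, key.1.symm⟩
end

section
/- The topological boundary (frontier) of the Minkowski sum □_d + n◊_d in ℝ^d equals the union, over all nonzero sign vectors S ∈ {-1,0,+1}^d, of the sets □_S + S·(nΔ_{supp(S)}). -/
open Pointwise

/-- The gauge `f x = ∑ max (|x i| - 1) 0`. -/
noncomputable def gaugeF {d : ℕ} (x : Fin d → ℝ) : ℝ := ∑ i, max (|x i| - 1) 0

theorem gaugeF_continuous {d : ℕ} : Continuous (gaugeF (d := d)) := by
  unfold gaugeF
  fun_prop

theorem sum_eq_sublevel (d : ℕ) (n : ℝ) :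
    cube d + diamond d n = {x | gaugeF x ≤ n} := by
  ext x
  simp only [Set.mem_add, cube, diamond, Set.mem_ofPred_eq, gaugeF]
  constructor
  · rintro ⟨a, ha, b, hb, rfl⟩
    refine le_trans (Finset.sum_le_sum fun i _ => ?_) hb
    have h1 := ha i
    have h2 := abs_add_le (a i) (b i)
    simp only [Pi.add_apply]
    exact max_le (by linarith) (abs_nonneg _)
  · intro h
    refine ⟨fun i => max (-1) (min (x i) 1), fun i => ?_,
      fun i => x i - max (-1) (min (x i) 1), ?_, ?_⟩
    · rw [abs_le]
      exact ⟨le_max_left _ _, max_le (by norm_num) (min_le_right _ _)⟩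
    · refine le_trans (Finset.sum_le_sum fun i _ => ?_) h
      simp only [abs, max_def, min_def]
      split_ifs <;> linarith
    · ext i
      simp

theorem frontier_sublevel {d : ℕ} (n : ℝ) (hn : 0 < n) :
    frontier {x : Fin d → ℝ | gaugeF x ≤ n} = {x | gaugeF x = n} := by
  apply Set.Subset.antisymm
  · exact frontier_le_subset_eq gaugeF_continuous continuous_const
  · intro x hx
    have hx' : gaugeF x = n := hx
    refine ⟨subset_closure hx'.le, fun hint => ?_⟩
    have hc : Continuous (fun t : ℝ => (1 + t) • x) := by fun_prop
    have hev : ∀ᶠ t in nhds (0 : ℝ), gaugeF ((1 + t) • x) ≤ n := by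
      have h0 : Filter.Tendsto (fun t : ℝ => (1 + t) • x) (nhds 0) (nhds x) := by
        simpa using hc.tendsto 0
      exact h0 (mem_interior_iff_mem_nhds.1 hint)
    obtain ⟨e, he, H⟩ := Metric.eventually_nhds_iff.1 hev
    have hk := H (y := e / 2) (by
      rw [Real.dist_eq, sub_zero, abs_of_pos (by linarith)]; linarith)
    have hge : (1 + e / 2) * gaugeF x ≤ gaugeF ((1 + e / 2) • x) := by
      unfold gaugeF
      rw [Finset.mul_sum]
      refine Finset.sum_le_sum fun i _ => ?_
      have hp : 0 ≤ 1 + e / 2 := by linarith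
      rw [mul_max_of_nonneg _ _ hp, mul_zero, Pi.smul_apply, smul_eq_mul, abs_mul,
        abs_of_nonneg hp]
      exact max_le_max (by linarith) le_rfl
    rw [hx'] at hge
    nlinarith

theorem level_eq_union {d : ℕ} (n : ℝ) (hn : 0 < n) :
    {x : Fin d → ℝ | gaugeF x = n} =
      ⋃ S ∈ {S : Fin d → SignType | S ≠ 0},
        cubeFace S + sdot S (simplexFace n {i | S i ≠ 0}) := by
  ext x
  simp only [Set.mem_iUnion, Set.mem_add, cubeFace, sdot, simplexFace, Set.mem_ofPred_eq,
    Set.mem_image, exists_prop]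
  constructor
  · intro hx
    refine ⟨fun i => if 1 < x i then 1 else if x i < -1 then -1 else 0, ?_,
      fun i => if 1 < x i then 1 else if x i < -1 then -1 else x i, ⟨?_, ?_⟩, _,
      ⟨fun i => max (|x i| - 1) 0, ⟨fun i => le_max_right _ _, ?_, hx⟩, rfl⟩, ?_⟩
    · intro h0
      have : gaugeF x = 0 := by
        unfold gaugeF
        refine Finset.sum_eq_zero fun i _ => ?_
        have := congrFun h0 i
        apply max_eq_right
        by_cases h1 : 1 < x i
        · simp [h1] at this
        · by_cases h2 : x i < -1
          · simp [h1, h2] at this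
          · have := abs_le.2 ⟨not_lt.1 h2, not_lt.1 h1⟩
            linarith
      linarith
    · intro i
      rw [abs_le]
      dsimp only
      split_ifs <;> constructor <;> linarith
    · intro i hi
      by_cases h1 : 1 < x i
      · simp [h1]
      · by_cases h2 : x i < -1
        · simp [h1, h2]
        · simp [h1, h2] at hi
    · intro i hi
      apply max_eq_right
      by_cases h1 : 1 < x i
      · simp [h1] at hi
      · by_cases h2 : x i < -1
        · simp [h1, h2] at hi
        · have := abs_le.2 ⟨not_lt.1 h2, not_lt.1 h1⟩
          linarith
    · ext i
      simp only [Pi.add_apply]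
      by_cases h1 : 1 < x i
      · have h3 : |x i| = x i := abs_of_pos (by linarith)
        have h4 : max (x i - 1) 0 = x i - 1 := max_eq_left (by linarith)
        simp [h1, h3, h4]
      · by_cases h2 : x i < -1
        · have h3 : |x i| = - x i := abs_of_neg (by linarith)
          have h4 : max (-x i - 1) 0 = -x i - 1 := max_eq_left (by linarith)
          simp [h1, h2, h3, h4]
        · simp [h1, h2]
  · rintro ⟨S, -, a, ⟨ha, haS⟩, _, ⟨b, ⟨hb, hbS, hsum⟩, rfl⟩, rfl⟩
    rw [← hsum]
    unfold gaugeF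
    refine Finset.sum_congr rfl fun i _ => ?_
    have hai := ha i
    have haSi := haS i
    have hbi := hb i
    have hbSi := hbS i
    simp only [Pi.add_apply]
    rcases hS : S i with _ | _ | _
    · have hS' : S i = 0 := hS
      have : b i = 0 := hbSi (by simp [hS'])
      rw [this]
      simpa using hai
    · have hS' : S i = -1 := hS
      have h := haSi (by simp [hS'])
      rw [h, hS']
      change max (|((-1 : SignType) : ℝ) + ((-1 : SignType) : ℝ) * b i| - 1) 0 = b i
      rw [SignType.coe_neg_one, abs_of_neg (by linarith), max_eq_left (by linarith)]
      ring
    · have hS' : S i = 1 := hS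
      have h := haSi (by simp [hS'])
      rw [h, hS']
      change max (|((1 : SignType) : ℝ) + ((1 : SignType) : ℝ) * b i| - 1) 0 = b i
      rw [SignType.coe_one, abs_of_pos (by linarith), max_eq_left (by linarith)]
      ring

theorem statement18 {d : ℕ} (hd : 1 ≤ d) (n : ℝ) (hn : 0 < n) :
    frontier (cube d + diamond d n) =
      ⋃ S ∈ {S : Fin d → SignType | S ≠ 0},
        cubeFace S + sdot S (simplexFace n {i | S i ≠ 0}) := by
  rw [sum_eq_sublevel, frontier_sublevel n hn, level_eq_union n hn]
end
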